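/- Let p > 3 be a prime, n > 4 an integer, and let G be the alternating group A_n or the symmetric group S_n. Let F be a field of characteristic p and M a finite-dimensional FG-module. Then (p-2)·dim H^2(G,M) ≤ dim M; in particular 3·dim H^2(G,M) ≤ dim M. -/

import Mathlib

namespace GroupCoh

open Module Representation

section LinearAlgebra

variable {F V V' V'' : Type} [Field F] [AddCommGroup V] [Module F V] [AddCommGroup V'] [Module F V']
  [AddCommGroup V''] [Module F V'']

lemma finrank_map_mkQ [FiniteDimensional F V] {B Z : Submodule F V} (h : B ≤ Z) :
    finrank F (Z.map B.mkQ) = finrank F Z - finrank F B := by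
  have h1 := LinearMap.finrank_range_add_finrank_ker (B.mkQ.domRestrict Z)
  have h2 : LinearMap.range (B.mkQ.domRestrict Z) = Z.map B.mkQ := by
    rw [LinearMap.domRestrict, LinearMap.range_comp, Submodule.range_subtype]
  have h3 : LinearMap.ker (B.mkQ.domRestrict Z) = B.submoduleOf Z := by
    rw [LinearMap.domRestrict, LinearMap.ker_comp, Submodule.ker_mkQ]; rfl
  rw [h2, h3, (Submodule.submoduleOfEquivOfLe h).finrank_eq] at h1
  omega

/-- Dimension count for an exact sequence `Z''/B'' → Z/B → Z'/B'` of subquotients. -/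
lemma finrank_sub_le_add [FiniteDimensional F V] [FiniteDimensional F V'] [FiniteDimensional F V'']
    {B Z : Submodule F V} {B' Z' : Submodule F V'} {B'' Z'' : Submodule F V''}
    (hB : B ≤ Z) (hB' : B' ≤ Z') (hB'' : B'' ≤ Z'') (φ : V →ₗ[F] V') (ψ : V'' →ₗ[F] V)
    (hφZ : ∀ z ∈ Z, φ z ∈ Z') (hφB : ∀ z ∈ B, φ z ∈ B') (hψB : ∀ z ∈ B'', ψ z ∈ B)
    (hex : ∀ z ∈ Z, φ z ∈ B' → ∃ y ∈ Z'', z - ψ y ∈ B) :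
    finrank F Z - finrank F B ≤
      (finrank F Z' - finrank F B') + (finrank F Z'' - finrank F B'') := by
  rw [← finrank_map_mkQ hB, ← finrank_map_mkQ hB', ← finrank_map_mkQ hB'']
  let φ' : (V ⧸ B) →ₗ[F] (V' ⧸ B') := B.mapQ B' φ hφB
  let ψ' : (V'' ⧸ B'') →ₗ[F] (V ⧸ B) := B''.mapQ B ψ hψB
  set W := Z.map B.mkQ
  have h1 := LinearMap.finrank_range_add_finrank_ker (φ'.domRestrict W)
  have h2 : LinearMap.range (φ'.domRestrict W) ≤ Z'.map B'.mkQ := by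
    rintro _ ⟨⟨_, z, hz, rfl⟩, rfl⟩
    exact ⟨φ z, hφZ z hz, rfl⟩
  have h3 : (LinearMap.ker (φ'.domRestrict W)).map W.subtype ≤ (Z''.map B''.mkQ).map ψ' := by
    rintro _ ⟨⟨_, z, hz, rfl⟩, hk, rfl⟩
    have hk' : φ z ∈ B' := by
      have : B'.mkQ (φ z) = 0 := hk
      simpa using this
    obtain ⟨y, hy, hyB⟩ := hex z hz hk'
    refine ⟨B''.mkQ y, ⟨y, hy, rfl⟩, ?_⟩
    have : B.mkQ (z - ψ y) = 0 := (Submodule.Quotient.mk_eq_zero _).2 hyB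
    rw [map_sub, sub_eq_zero] at this
    exact this.symm
  have h4 := Submodule.finrank_mono h2
  have h5 := Submodule.finrank_mono h3
  rw [Submodule.finrank_map_subtype_eq] at h5
  have h6 := Submodule.finrank_map_le ψ' (Z''.map B''.mkQ)
  omega

lemma finrank_sub_le [FiniteDimensional F V] [FiniteDimensional F V']
    {B Z : Submodule F V} {B' Z' : Submodule F V'}
    (hB : B ≤ Z) (hB' : B' ≤ Z') (φ : V →ₗ[F] V')
    (hφZ : ∀ z ∈ Z, φ z ∈ Z') (hφB : ∀ z ∈ B, φ z ∈ B')
    (hex : ∀ z ∈ Z, φ z ∈ B' → z ∈ B) :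
    finrank F Z - finrank F B ≤ finrank F Z' - finrank F B' := by
  have := finrank_sub_le_add hB hB' (le_refl (⊥ : Submodule F V)) φ LinearMap.id hφZ hφB
    (by simp) (fun z hz h => ⟨0, by simp, by simpa using hex z hz h⟩)
  omega

end LinearAlgebra

variable {F G H M N : Type} [Field F] [Group G] [Group H] [AddCommGroup M] [Module F M]
  [AddCommGroup N] [Module F N]

/-- The coboundary from `M` to functions `G → M`. -/
def d0 (ρ : Representation F G M) : M →ₗ[F] (G → M) where
  toFun m g := ρ g m - m
  map_add' x y := by ext g; simp; abel
  map_smul' r x := by ext g; simp [smul_sub]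

/-- The coboundary from 1-cochains to 2-cochains. -/
def d1 (ρ : Representation F G M) : (G → M) →ₗ[F] (G × G → M) where
  toFun c g := ρ g.1 (c g.2) - c (g.1 * g.2) + c g.1
  map_add' x y := by ext g; simp; abel
  map_smul' r x := by ext g; simp [smul_sub]

/-- 1-cocycles. -/
def Z1 (ρ : Representation F G M) : Submodule F (G → M) where
  carrier := {c | ∀ g h, c (g * h) = c g + ρ g (c h)}
  zero_mem' := by simp
  add_mem' {a b} ha hb g h := by simp [ha g h, hb g h]; abel
  smul_mem' r a ha g h := by simp [ha g h]

/-- 2-cocycles. -/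
def Z2 (ρ : Representation F G M) : Submodule F (G × G → M) where
  carrier := {f | ∀ g h j, ρ g (f (h, j)) + f (g, h * j) = f (g * h, j) + f (g, h)}
  zero_mem' := by simp
  add_mem' {a b} ha hb g h j := by
    have h1 := ha g h j
    have h2 := hb g h j
    simp only [Pi.add_apply, map_add]
    calc _ = (ρ g (a (h, j)) + a (g, h * j)) + (ρ g (b (h, j)) + b (g, h * j)) := by abel
      _ = _ := by rw [h1, h2]; abel
  smul_mem' r a ha g h j := by
    simp only [Pi.smul_apply, map_smul, ← smul_add, ha g h j]

/-- 1-coboundaries. -/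
def B1 (ρ : Representation F G M) : Submodule F (G → M) := LinearMap.range (d0 ρ)

/-- 2-coboundaries. -/
def B2 (ρ : Representation F G M) : Submodule F (G × G → M) := LinearMap.range (d1 ρ)

/-- The dimension of the first cohomology. -/
noncomputable def dimH1 (ρ : Representation F G M) : ℕ := finrank F (Z1 ρ) - finrank F (B1 ρ)

/-- The dimension of the second cohomology. -/
noncomputable def dimH2 (ρ : Representation F G M) : ℕ := finrank F (Z2 ρ) - finrank F (B2 ρ)

lemma B1_le_Z1 (ρ : Representation F G M) : B1 ρ ≤ Z1 ρ := by
  rintro _ ⟨m, rfl⟩ g h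
  simp [d0]

lemma B2_le_Z2 (ρ : Representation F G M) : B2 ρ ≤ Z2 ρ := by
  rintro _ ⟨m, rfl⟩ g h j
  simp [d1, mul_assoc]
  abel

lemma Z1_one {ρ : Representation F G M} {c : G → M} (hc : c ∈ Z1 ρ) : c 1 = 0 := by
  have := hc 1 1
  simpa using this

lemma mem_B1 {ρ : Representation F G M} {c : G → M} : c ∈ B1 ρ ↔ ∃ m, ∀ g, c g = ρ g m - m :=
  ⟨fun ⟨m, hm⟩ => ⟨m, fun g => by rw [← hm]; rfl⟩, fun ⟨m, hm⟩ => ⟨m, by ext g; rw [hm]; rfl⟩⟩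

lemma mem_B2 {ρ : Representation F G M} {f : G × G → M} :
    f ∈ B2 ρ ↔ ∃ c : G → M, ∀ g h, f (g, h) = ρ g (c h) - c (g * h) + c g :=
  ⟨fun ⟨m, hm⟩ => ⟨m, fun g h => by rw [← hm]; rfl⟩,
    fun ⟨m, hm⟩ => ⟨m, by ext ⟨g, h⟩; rw [hm]; rfl⟩⟩

lemma dimH1_eq_zero {ρ : Representation F G M} (h : Z1 ρ ≤ B1 ρ) : dimH1 ρ = 0 := by
  rw [dimH1, le_antisymm h (B1_le_Z1 ρ), Nat.sub_self]

variable [Finite G] [Finite H] [FiniteDimensional F M] [FiniteDimensional F N]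

lemma Z1_le_B1 {ρ : Representation F G M} (h : dimH1 ρ = 0) : Z1 ρ ≤ B1 ρ :=
  (Submodule.eq_of_le_of_finrank_le (B1_le_Z1 ρ) (Nat.sub_eq_zero_iff_le.1 h)).ge

section ExactSequences

variable {F G W V C : Type} [Field F] [Group G] [Finite G] [AddCommGroup W] [Module F W]
  [AddCommGroup V] [Module F V] [AddCommGroup C] [Module F C]
  [FiniteDimensional F W] [FiniteDimensional F V] [FiniteDimensional F C]
  {ρW : Representation F G W} {ρV : Representation F G V} {ρC : Representation F G C}

/-- Half-exactness of `H¹`. -/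
lemma dimH1_le_add (i : W →ₗ[F] V) (q : V →ₗ[F] C) (hi : Function.Injective i)
    (hq : Function.Surjective q) (hex : LinearMap.ker q = LinearMap.range i)
    (hi' : ∀ g w, i (ρW g w) = ρV g (i w)) (hq' : ∀ g v, q (ρV g v) = ρC g (q v)) :
    dimH1 ρV ≤ dimH1 ρW + dimH1 ρC := by
  have hex' : ∀ v, q v = 0 ↔ ∃ w, i w = v := fun v => by
    rw [← LinearMap.mem_ker, hex, LinearMap.mem_range]
  rw [add_comm]
  refine finrank_sub_le_add (B1_le_Z1 _) (B1_le_Z1 _) (B1_le_Z1 _)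
    (q.compLeft G) (i.compLeft G) ?_ ?_ ?_ ?_
  · intro z hz g h
    simp [hz g h, hq']
  · intro z hz
    obtain ⟨m, hm⟩ := mem_B1.1 hz
    exact mem_B1.2 ⟨q m, fun g => by simp [hm, hq']⟩
  · intro z hz
    obtain ⟨m, hm⟩ := mem_B1.1 hz
    exact mem_B1.2 ⟨i m, fun g => by simp [hm, hi']⟩
  · intro z hz hzB
    obtain ⟨y, hy⟩ := mem_B1.1 hzB
    obtain ⟨v, rfl⟩ := hq y
    have : ∀ g, ∃ w, i w = z g - (ρV g v - v) := fun g => by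
      rw [← hex', map_sub, map_sub, hq', ← hy g, sub_eq_zero]; rfl
    choose w hw using this
    refine ⟨w, fun g h => hi ?_, mem_B1.2 ⟨v, fun g => ?_⟩⟩
    · rw [map_add, hi', hw, hw, hw, hz g h]
      simp only [map_mul, Module.End.mul_apply, map_sub]
      abel
    · simp [hw]

/-- Dimension shifting from `H¹` to `H²`. -/
lemma dimH1_le_dimH2 (i : W →ₗ[F] V) (q : V →ₗ[F] C) (hi : Function.Injective i)
    (hq : Function.Surjective q) (hex : LinearMap.ker q = LinearMap.range i)
    (hi' : ∀ g w, i (ρW g w) = ρV g (i w)) (hq' : ∀ g v, q (ρV g v) = ρC g (q v))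
    (hV : Z1 ρV ≤ B1 ρV) : dimH1 ρC ≤ dimH2 ρW := by
  have hex' : ∀ v, q v = 0 ↔ ∃ w, i w = v := fun v => by
    rw [← LinearMap.mem_ker, hex, LinearMap.mem_range]
  obtain ⟨s, hs⟩ := q.exists_rightInverse_of_surjective (LinearMap.range_eq_top.2 hq)
  obtain ⟨r, hr⟩ := i.exists_leftInverse_of_injective (LinearMap.ker_eq_bot.2 hi)
  have hs' : ∀ y, q (s y) = y := fun y => LinearMap.congr_fun hs y
  have hr' : ∀ y, r (i y) = y := fun y => LinearMap.congr_fun hr y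
  have hir : ∀ v, q v = 0 → i (r v) = v := fun v hv => by
    obtain ⟨w, rfl⟩ := (hex' v).1 hv
    rw [hr']
  refine finrank_sub_le (B1_le_Z1 _) (B2_le_Z2 _) ((r.compLeft _).comp
    ((d1 ρV).comp (s.compLeft G))) ?_ ?_ ?_
  · intro c hc
    have key : ∀ x, i (r (d1 ρV (s.compLeft G c) x)) = d1 ρV (s.compLeft G c) x := fun x => hir _ (by
      simp [d1, hq', hs', hc x.1 x.2])
    have : d1 ρV (s.compLeft G c) ∈ Z2 ρV := B2_le_Z2 _ ⟨_, rfl⟩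
    intro g h j
    apply hi
    have := this g h j
    simp only [LinearMap.comp_apply, LinearMap.compLeft_apply, Function.comp_apply, map_add, hi',
      key] at this ⊢
    exact this
  · intro c hc
    obtain ⟨m, hm⟩ := mem_B1.1 hc
    have : ∀ g, ∃ w, i w = s (c g) - (ρV g (s m) - s m) := fun g => by
      rw [← hex', map_sub, map_sub, hq', hs', hs', hm, sub_self]
    choose w hw using this
    refine mem_B2.2 ⟨w, fun g h => hi ?_⟩
    simp only [LinearMap.comp_apply, LinearMap.compLeft_apply, Function.comp_apply]
    rw [hir, map_add, map_sub, hi', hw, hw, hw]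
    · simp [d1]
      abel
    · simp [d1, hq', hs', hm]
  · intro c hc hB
    obtain ⟨k, hk⟩ := mem_B2.1 hB
    have : (fun g => s (c g) - i (k g)) ∈ Z1 ρV := by
      intro g h
      have h1 := congrArg i (hk g h)
      simp only [LinearMap.comp_apply, LinearMap.compLeft_apply, Function.comp_apply] at h1
      rw [hir _ (by simp [d1, hq', hs', hc g h]), map_add, map_sub, hi'] at h1
      simp only [d1, LinearMap.coe_mk, AddHom.coe_mk, LinearMap.compLeft_apply,
        Function.comp_apply] at h1
      change s (c (g * h)) - i (k (g * h)) = s (c g) - i (k g) + ρV g (s (c h) - i (k h))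
      rw [map_sub]
      linear_combination (norm := abel) -h1
    obtain ⟨v, hv⟩ := mem_B1.1 (hV this)
    refine mem_B1.2 ⟨q v, fun g => ?_⟩
    have h2 := congrArg q (hv g)
    have h3 : q (i (k g)) = 0 := (hex' _).2 ⟨_, rfl⟩
    rw [map_sub, map_sub, hs', hq', h3, sub_zero] at h2
    exact h2

end ExactSequences

section Shift

variable {F G H B M : Type} [Field F] [Group G] [Group H] [Group B] [AddCommGroup M] [Module F M]

/-- Restriction of a representation along a homomorphism. -/
abbrev res (ρ : Representation F G M) (e : H →* G) : Representation F H M := MonoidHom.comp ρ e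

/-- The right translation representation on functions. -/
def coindRep (F G M : Type) [Field F] [Group G] [AddCommGroup M] [Module F M] :
    Representation F G (G → M) where
  toFun g := LinearMap.funLeft F M (· * g)
  map_one' := by ext; simp
  map_mul' a b := by ext; simp [mul_assoc]

@[simp] lemma coindRep_apply (g x : G) (φ : G → M) : coindRep F G M g φ x = φ (x * g) := rfl

/-- The embedding of a module in its coinduced module. -/
def unitMap (ρ : Representation F G M) : M →ₗ[F] (G → M) := LinearMap.pi fun g => ρ g

@[simp] lemma unitMap_apply (ρ : Representation F G M) (m : M) (x : G) :
    unitMap ρ m x = ρ x m := rfl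

lemma unitMap_injective (ρ : Representation F G M) : Function.Injective (unitMap ρ) :=
  fun a b h => by simpa using congrFun h 1

lemma unitMap_equivariant (ρ : Representation F G M) (g : G) (m : M) :
    unitMap ρ (ρ g m) = coindRep F G M g (unitMap ρ m) := by
  ext x; simp

/-- The cokernel of the embedding in the coinduced module. -/
abbrev Shift (ρ : Representation F G M) : Type := (G → M) ⧸ LinearMap.range (unitMap ρ)

/-- The action on `Shift ρ`. -/
def shiftRep (ρ : Representation F G M) : Representation F G (Shift ρ) :=
  (coindRep F G M).quotient _ fun g => by
    rintro _ ⟨m, rfl⟩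
    exact ⟨ρ g m, unitMap_equivariant ρ g m⟩

/-- The projection to `Shift ρ`. -/
abbrev shiftMk (ρ : Representation F G M) : (G → M) →ₗ[F] Shift ρ := Submodule.mkQ _

lemma shiftMk_equivariant (ρ : Representation F G M) (g : G) (φ : G → M) :
    shiftMk ρ (coindRep F G M g φ) = shiftRep ρ g (shiftMk ρ φ) := rfl

lemma shiftMk_surjective (ρ : Representation F G M) : Function.Surjective (shiftMk ρ) :=
  Submodule.mkQ_surjective _

lemma shiftMk_eq_iff (ρ : Representation F G M) (φ ψ : G → M) :
    shiftMk ρ φ = shiftMk ρ ψ ↔ ∃ m, ∀ x, φ x = ψ x + ρ x m := by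
  rw [Submodule.mkQ_apply, Submodule.mkQ_apply, Submodule.Quotient.eq]
  constructor
  · rintro ⟨m, hm⟩
    exact ⟨m, fun x => by have := congrFun hm x; simp at this; rw [this]; abel⟩
  · rintro ⟨m, hm⟩
    exact ⟨m, by ext x; simp [hm]⟩

/-- Dimension shifting from `H²` to `H¹`. -/
lemma dimH2_le_shift [Finite G] [FiniteDimensional F M] (ρ : Representation F G M) :
    dimH2 ρ ≤ dimH1 (shiftRep ρ) := by
  refine finrank_sub_le (B2_le_Z2 _) (B1_le_Z1 _)
    (LinearMap.pi fun g => (shiftMk ρ).comp (LinearMap.funLeft F M fun x => (x, g))) ?_ ?_ ?_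
  · intro f hf g h
    simp only [LinearMap.pi_apply, LinearMap.comp_apply]
    rw [← shiftMk_equivariant, ← map_add, shiftMk_eq_iff]
    refine ⟨-f (g, h), fun x => ?_⟩
    have := hf x g h
    simp only [LinearMap.funLeft_apply, Pi.add_apply, coindRep_apply, map_neg]
    linear_combination (norm := abel) this
  · intro f hf
    obtain ⟨k, hk⟩ := mem_B2.1 hf
    refine mem_B1.2 ⟨-shiftMk ρ k, fun g => ?_⟩
    simp only [LinearMap.pi_apply, LinearMap.comp_apply]
    rw [← map_neg, ← shiftMk_equivariant, ← map_sub, shiftMk_eq_iff]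
    refine ⟨k g, fun x => ?_⟩
    simp [hk]
    abel
  · intro f hf hB
    obtain ⟨φ, hφ⟩ := mem_B1.1 hB
    obtain ⟨φ, rfl⟩ := shiftMk_surjective ρ φ
    have : ∀ g, ∃ m, ∀ x, f (x, g) = φ (x * g) - φ x + ρ x m := by
      intro g
      have := hφ g
      simp only [LinearMap.pi_apply, LinearMap.comp_apply] at this
      rw [← shiftMk_equivariant, ← map_sub, shiftMk_eq_iff] at this
      exact this
    choose k hk using this
    refine mem_B2.2 ⟨k, fun x g => ?_⟩
    have key : ∀ g h, (k (g * h) + φ (g * h)) = k g + φ g := by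
      intro g h
      have h2 := hf g⁻¹ g h
      simp only [hk, map_add, map_sub, map_one, one_mul, Module.End.one_apply,
        inv_mul_cancel, inv_mul_cancel_left, ← Module.End.mul_apply, ← map_mul] at h2
      have h3 : ρ g⁻¹ ((k (g * h) + φ (g * h)) - (k g + φ g)) = 0 := by
        simp only [map_add, map_sub]
        linear_combination (norm := abel) h2
      have h4 := congrArg (ρ g) h3
      rw [map_zero, ← Module.End.mul_apply, ← map_mul, mul_inv_cancel, map_one,
        Module.End.one_apply, sub_eq_zero] at h4
      exact h4
    have := key x g
    rw [hk]
    linear_combination (norm := abel) this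

lemma coindRep_res_Z1_le (e : H →* G) (he : Function.Injective e) :
    Z1 (res (coindRep F G M) e) ≤ B1 (res (coindRep F G M) e) := by
  intro c hc
  let r : G → G := fun x => (x : G ⧸ e.range).out
  have hr : ∀ x, ∃ b, e b = (r x)⁻¹ * x := fun x => by
    have : ((r x : G) : G ⧸ e.range) = (x : G ⧸ e.range) := Quotient.out_eq _
    exact QuotientGroup.eq.1 this
  choose b hb using hr
  have hre : ∀ x a, r (x * e a) = r x := fun x a => by
    have : ((x * e a : G) : G ⧸ e.range) = x := by simp
    simp only [r]; rw [this]
  have hbe : ∀ x a, b (x * e a) = b x * a := fun x a => he (by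
    rw [map_mul, hb, hb, hre, mul_assoc])
  refine mem_B1.2 ⟨fun x => c (b x) (r x), fun a => ?_⟩
  ext x
  have h1 := congrFun (hc (b x) a) (r x)
  simp only [MonoidHom.comp_apply, Pi.add_apply, coindRep_apply, hb, mul_inv_cancel_left] at h1
  simp [hre, hbe, h1]

lemma dimH1_shift_res_le [Finite G] [Finite H] [FiniteDimensional F M] (ρ : Representation F G M)
    (e : H →* G) (he : Function.Injective e) :
    dimH1 (res (shiftRep ρ) e) ≤ dimH2 (res ρ e) :=
  dimH1_le_dimH2 (ρV := res (coindRep F G M) e) (unitMap ρ) (shiftMk ρ) (unitMap_injective ρ)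
    (shiftMk_surjective ρ) (Submodule.ker_mkQ _) (fun g => unitMap_equivariant ρ (e g))
    (fun g => shiftMk_equivariant ρ (e g)) (coindRep_res_Z1_le e he)

end Shift

section Invariants

variable {F G H B M : Type} [Field F] [Group G] [Group H] [Group B] [AddCommGroup M] [Module F M]

/-- The vectors fixed by the kernel of `π`. -/
def invSub (π : G →* B) (ρ : Representation F G M) : Submodule F M where
  carrier := {v | ∀ a, π a = 1 → ρ a v = v}
  zero_mem' := by simp
  add_mem' {v w} hv hw a ha := by rw [map_add, hv a ha, hw a ha]
  smul_mem' r v hv a ha := by rw [map_smul, hv a ha]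

lemma apply_mem_invSub {π : G →* B} {ρ : Representation F G M} {v : M} (hv : v ∈ invSub π ρ)
    (g : G) : ρ g v ∈ invSub π ρ := fun a ha => by
  have := hv (g⁻¹ * a * g) (by simp [ha])
  have := congrArg (ρ g) this
  simp only [← Module.End.mul_apply, ← map_mul] at this ⊢
  rw [← this]
  group

lemma apply_eq_of_mem_invSub {π : G →* B} {ρ : Representation F G M} {v : M}
    (hv : v ∈ invSub π ρ) {g h : G} (hgh : π g = π h) : ρ g v = ρ h v := by
  have := congrArg (ρ g) (hv (g⁻¹ * h) (by simp [hgh]))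
  rw [← Module.End.mul_apply, ← map_mul, mul_inv_cancel_left] at this
  exact this.symm

/-- The action of the quotient on the vectors fixed by the kernel. -/
noncomputable def invRep {π : G →* B} (hπ : Function.Surjective π) (ρ : Representation F G M) :
    Representation F B (invSub π ρ) where
  toFun b := (ρ (Function.surjInv hπ b)).restrict fun _ hv => apply_mem_invSub hv _
  map_one' := by
    ext v
    exact v.2 _ (Function.surjInv_eq hπ 1)
  map_mul' a b := by
    ext v
    change ρ _ v.1 = ρ _ (ρ _ v.1)
    rw [← Module.End.mul_apply, ← map_mul]
    exact apply_eq_of_mem_invSub v.2 (by simp [Function.surjInv_eq])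

lemma invRep_apply {π : G →* B} (hπ : Function.Surjective π) (ρ : Representation F G M)
    (g : G) (v : invSub π ρ) : (invRep hπ ρ (π g) v : M) = ρ g v :=
  apply_eq_of_mem_invSub v.2 (Function.surjInv_eq hπ _)

lemma finrank_invariants_le [FiniteDimensional F M] {π : G →* B} (hπ : Function.Surjective π)
    (ρ : Representation F G M) :
    finrank F (invariants ρ) ≤ finrank F (invariants (invRep hπ ρ)) := by
  refine le_trans (Submodule.finrank_mono ?_)
    (Submodule.finrank_map_le (invSub π ρ).subtype (invariants (invRep hπ ρ)))
  intro v hv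
  refine ⟨⟨v, fun a _ => hv a⟩, fun b => ?_, rfl⟩
  obtain ⟨g, rfl⟩ := hπ b
  exact Subtype.ext ((invRep_apply hπ ρ g _).trans (hv g))

variable [Finite G] [Finite B] [Finite H] [FiniteDimensional F M]

/-- Inflation is injective on `H¹`. -/
lemma dimH1_invRep_le {π : G →* B} (hπ : Function.Surjective π) (ρ : Representation F G M) :
    dimH1 (invRep hπ ρ) ≤ dimH1 ρ := by
  refine finrank_sub_le (B1_le_Z1 _) (B1_le_Z1 _)
    (((invSub π ρ).subtype.compLeft G).comp (LinearMap.funLeft F _ π)) ?_ ?_ ?_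
  · intro c hc g h
    simp [hc (π g) (π h), invRep_apply]
  · intro c hc
    obtain ⟨m, hm⟩ := mem_B1.1 hc
    exact mem_B1.2 ⟨m, fun g => by simp [hm, invRep_apply]⟩
  · intro c hc hB
    obtain ⟨m, hm⟩ := mem_B1.1 hB
    have hm' : m ∈ invSub π ρ := fun a ha => by
      have := hm a
      simp only [LinearMap.comp_apply, LinearMap.compLeft_apply, Function.comp_apply,
        LinearMap.funLeft_apply, ha, Z1_one hc, map_zero] at this
      exact (sub_eq_zero.1 this.symm)
    refine mem_B1.2 ⟨⟨m, hm'⟩, fun b => Subtype.ext ?_⟩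
    obtain ⟨g, rfl⟩ := hπ b
    rw [Submodule.coe_sub, invRep_apply]
    exact hm g

/-- A 1-cocycle that vanishes on the kernel of `π` is inflated. -/
lemma exists_inflation {π : G →* B} (hπ : Function.Surjective π) {ρ : Representation F G M}
    {c : G → M} (hc : c ∈ Z1 ρ) (h0 : ∀ a, π a = 1 → c a = 0) :
    ∃ c' ∈ Z1 (invRep hπ ρ), ∀ g, (c' (π g) : M) = c g := by
  have hconst : ∀ g h, π g = π h → c g = c h := fun g h hgh => by
    have := hc g (g⁻¹ * h)
    rw [h0 (g⁻¹ * h) (by simp [hgh]), map_zero, add_zero, mul_inv_cancel_left] at this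
    exact this.symm
  have hmem : ∀ g, c g ∈ invSub π ρ := fun g a ha => by
    have := hc a g
    rw [h0 a ha, zero_add, hconst (a * g) g (by simp [ha])] at this
    exact this.symm
  have hsp : ∀ g, c (Function.surjInv hπ (π g)) = c g := fun g =>
    hconst _ _ (Function.surjInv_eq hπ _)
  refine ⟨fun b => ⟨c (Function.surjInv hπ b), hmem _⟩, fun a b => Subtype.ext ?_, hsp⟩
  obtain ⟨g, rfl⟩ := hπ a
  obtain ⟨h, rfl⟩ := hπ b
  rw [Submodule.coe_add, invRep_apply]
  simp only [hsp]
  rw [← map_mul, hsp, hc g h]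

/-- Inflation-restriction. -/
lemma dimH1_le_inf_res {π : G →* B} (hπ : Function.Surjective π) (ρ : Representation F G M)
    (e : H →* G) (he : π.ker ≤ e.range) :
    dimH1 ρ ≤ dimH1 (invRep hπ ρ) + dimH1 (res ρ e) := by
  rw [add_comm]
  refine finrank_sub_le_add (B1_le_Z1 _) (B1_le_Z1 _) (B1_le_Z1 _) (LinearMap.funLeft F _ e)
    (((invSub π ρ).subtype.compLeft G).comp (LinearMap.funLeft F _ π)) ?_ ?_ ?_ ?_
  · intro c hc g h
    simp [hc (e g) (e h)]
  · intro c hc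
    obtain ⟨m, hm⟩ := mem_B1.1 hc
    exact mem_B1.2 ⟨m, fun g => by simp [hm]⟩
  · intro c hc
    obtain ⟨m, hm⟩ := mem_B1.1 hc
    exact mem_B1.2 ⟨m, fun g => by simp [hm, invRep_apply]⟩
  · intro c hc hB
    obtain ⟨m, hm⟩ := mem_B1.1 hB
    obtain ⟨c', hc', hcc⟩ := exists_inflation hπ
      (Submodule.sub_mem _ hc (B1_le_Z1 ρ ⟨m, rfl⟩)) (fun a ha => by
        obtain ⟨b, rfl⟩ := he ha
        have := hm b
        simp only [LinearMap.funLeft_apply] at this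
        simp [d0, this])
    refine ⟨c', hc', ⟨m, ?_⟩⟩
    ext g
    simp [hcc]

end Invariants

section Index

variable {F G H M : Type} [Field F] [Group G] [Group H] [AddCommGroup M] [Module F M]
  [Finite G] [Finite H] [FiniteDimensional F M]

/-- Restriction is injective on `H¹` for subgroups of invertible index. -/
lemma dimH1_le_res (ρ : Representation F G M) (e : H →* G) (he : (e.range.index : F) ≠ 0) :
    dimH1 ρ ≤ dimH1 (res ρ e) := by
  refine finrank_sub_le (B1_le_Z1 _) (B1_le_Z1 _) (LinearMap.funLeft F _ e) ?_ ?_ ?_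
  · intro c hc g h
    simp [hc (e g) (e h)]
  · intro c hc
    obtain ⟨m, hm⟩ := mem_B1.1 hc
    exact mem_B1.2 ⟨m, fun g => by simp [hm]⟩
  · intro c hc hB
    obtain ⟨m, hm⟩ := mem_B1.1 hB
    set c' := c - d0 ρ m with hc'
    have hcc : c' ∈ Z1 ρ := Submodule.sub_mem _ hc (B1_le_Z1 ρ ⟨m, rfl⟩)
    have h0 : ∀ b, c' (e b) = 0 := fun b => by
      have := hm b
      simp only [LinearMap.funLeft_apply] at this
      simp [hc', d0, this]
    have : c' ∈ B1 ρ := by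
      have hconst : ∀ g h : G, (g : G ⧸ e.range) = h → c' g = c' h := fun g h hgh => by
        obtain ⟨b, hb⟩ := QuotientGroup.eq.1 hgh
        have := hcc g (e b)
        rw [h0, map_zero, add_zero, hb, mul_inv_cancel_left] at this
        exact this.symm
      have hout : ∀ g : G, c' (g : G ⧸ e.range).out = c' g := fun g =>
        hconst _ _ (Quotient.out_eq _)
      have := Fintype.ofFinite (G ⧸ e.range)
      let S := ∑ x : G ⧸ e.range, c' x.out
      have key : ∀ g, S = (e.range.index : F) • c' g + ρ g S := fun g => by
        have h1 : S = ∑ x : G ⧸ e.range, c' (g • x).out :=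
          (Equiv.sum_comp (MulAction.toPerm g) fun x : G ⧸ e.range => c' x.out).symm
        have h2 : ∀ x : G ⧸ e.range, c' (g • x).out = c' g + ρ g (c' x.out) := fun x => by
          rw [← hcc]
          apply hconst
          have : ((x.out : G) : G ⧸ e.range) = x := Quotient.out_eq _
          rw [← smul_eq_mul, ← MulAction.Quotient.smul_coe, this]
          exact Quotient.out_eq _
        refine h1.trans ?_
        simp only [h2, Finset.sum_add_distrib, Finset.sum_const, Finset.card_univ]
        rw [map_sum, Subgroup.index, Nat.card_eq_fintype_card, Nat.cast_smul_eq_nsmul]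
      refine mem_B1.2 ⟨-((e.range.index : F)⁻¹ • S), fun g => ?_⟩
      have h3 : (e.range.index : F) • c' g = S - ρ g S := by
        rw [eq_sub_iff_add_eq]; exact (key g).symm
      rw [← inv_smul_smul₀ he (c' g), h3, map_neg, map_smul, smul_sub]
      abel
    have h4 := Submodule.add_mem _ this (⟨m, rfl⟩ : d0 ρ m ∈ B1 ρ)
    rwa [hc', sub_add_cancel] at h4

/-- Restriction is injective on `H²` for subgroups of invertible index. -/
lemma dimH2_le_res (ρ : Representation F G M) (e : H →* G) (hi : Function.Injective e)
    (he : (e.range.index : F) ≠ 0) : dimH2 ρ ≤ dimH2 (res ρ e) :=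
  (dimH2_le_shift ρ).trans ((dimH1_le_res _ e he).trans (dimH1_shift_res_le ρ e hi))

end Index

section Bounds

/-- The bound `dim M^G + d (dim H¹(G,M) + dim H²(G,M)) ≤ dim M` for all modules. -/
def StrongBound (F : Type) [Field F] (d : ℕ) (G : Type) [Group G] : Prop :=
  ∀ (M : Type) [AddCommGroup M] [Module F M] [FiniteDimensional F M] (ρ : Representation F G M),
    finrank F (invariants ρ) + d * (dimH1 ρ + dimH2 ρ) ≤ finrank F M

/-- The bound `d dim H²(G,M) ≤ dim M` for all modules. -/
def WeakBound (F : Type) [Field F] (d : ℕ) (G : Type) [Group G] : Prop :=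
  ∀ (M : Type) [AddCommGroup M] [Module F M] [FiniteDimensional F M] (ρ : Representation F G M),
    d * dimH2 ρ ≤ finrank F M

variable {F : Type} [Field F] {d : ℕ} {G H : Type} [Group G] [Group H]

lemma StrongBound.weak (h : StrongBound F d G) : WeakBound F d G := fun M _ _ _ ρ => by
  have := h M ρ
  rw [mul_add] at this
  omega

variable [Finite G] [Finite H]

lemma StrongBound.of_index (h : StrongBound F d H) (e : H →* G) (hi : Function.Injective e)
    (he : (e.range.index : F) ≠ 0) : StrongBound F d G := fun M _ _ _ ρ => by
  have h0 := h M (res ρ e)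
  have h1 := dimH1_le_res ρ e he
  have h2 := dimH2_le_res ρ e hi he
  have h3 : finrank F (invariants ρ) ≤ finrank F (invariants (res ρ e)) :=
    Submodule.finrank_mono fun v hv b => hv (e b)
  have h4 := Nat.mul_le_mul_left d (add_le_add h1 h2)
  omega

lemma WeakBound.of_index (h : WeakBound F d H) (e : H →* G) (hi : Function.Injective e)
    (he : (e.range.index : F) ≠ 0) : WeakBound F d G := fun M _ _ _ ρ =>
  (Nat.mul_le_mul_left d (dimH2_le_res ρ e hi he)).trans (h M (res ρ e))

lemma StrongBound.of_mulEquiv (h : StrongBound F d H) (e : H ≃* G) : StrongBound F d G :=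
  h.of_index e.toMonoidHom e.injective (by
    rw [MonoidHom.range_eq_top.2 e.surjective, Subgroup.index_top]; simp)

lemma WeakBound.of_mulEquiv (h : WeakBound F d H) (e : H ≃* G) : WeakBound F d G :=
  h.of_index e.toMonoidHom e.injective (by
    rw [MonoidHom.range_eq_top.2 e.surjective, Subgroup.index_top]; simp)

lemma StrongBound.of_subsingleton [Subsingleton G] : StrongBound F d G := fun M _ _ _ ρ => by
  have hρ : ∀ (g : G), ρ g = 1 := fun g => by rw [Subsingleton.elim g 1, map_one]
  have h1 : Z1 ρ ≤ B1 ρ := fun c hc => mem_B1.2 ⟨0, fun g => by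
    rw [Subsingleton.elim g 1, Z1_one hc]; simp⟩
  have h2 : Z2 ρ ≤ B2 ρ := fun f hf => mem_B2.2 ⟨fun _ => f (1, 1), fun g h => by
    rw [Subsingleton.elim g 1, Subsingleton.elim h 1]; simp⟩
  have h3 : dimH1 ρ = 0 := by rw [dimH1, le_antisymm h1 (B1_le_Z1 ρ), Nat.sub_self]
  have h4 : dimH2 ρ = 0 := by rw [dimH2, le_antisymm h2 (B2_le_Z2 ρ), Nat.sub_self]
  rw [h3, h4, add_zero, mul_zero, add_zero]
  exact Submodule.finrank_le _

/-- The order of the group is invertible. -/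
lemma StrongBound.of_card (h : (Nat.card G : F) ≠ 0) : StrongBound F d G :=
  (StrongBound.of_subsingleton (G := Unit)).of_index (1 : Unit →* G)
    (fun _ _ _ => rfl) (by
      rw [show (1 : Unit →* G).range = ⊥ from MonoidHom.range_eq_bot_iff.2 rfl, Subgroup.index_bot]
      exact h)

end Bounds

/-- The vectors fixed by one group element. -/
def fixedOf {F G M : Type} [Field F] [Group G] [AddCommGroup M] [Module F M]
    (ρ : Representation F G M) (u : G) : Submodule F M := LinearMap.ker (ρ u - LinearMap.id)

lemma dimH1_le_sub_add_quotient {F B Y : Type} [Field F] [Group B] [AddCommGroup Y] [Module F Y]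
    [Finite B] [FiniteDimensional F Y] (σ : Representation F B Y) (R : Submodule F Y)
    (hR : ∀ g, R ≤ R.comap (σ g)) :
    dimH1 σ ≤ dimH1 (σ.subrepresentation R hR) + dimH1 (σ.quotient R hR) :=
  dimH1_le_add (ρV := σ) R.subtype R.mkQ (Submodule.subtype_injective _)
      (Submodule.mkQ_surjective _) (by rw [Submodule.ker_mkQ, Submodule.range_subtype])
      (fun _ _ => rfl) (fun _ _ => rfl)

/-- For an exact sequence `0 → W → E → Y` with `H¹(E) = 0`, the first cohomology of `Y` is
bounded by the second cohomology of `W` and the first of the cokernel. -/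
lemma dimH1_le_dimH2_add {F B W E Y : Type} [Field F] [Group B] [AddCommGroup Y] [Module F Y]
    [AddCommGroup W] [Module F W] [AddCommGroup E] [Module F E]
    [Finite B] [FiniteDimensional F Y] [FiniteDimensional F W] [FiniteDimensional F E]
    {ρ : Representation F B W} {τ : Representation F B E} {σ : Representation F B Y}
    (i : W →ₗ[F] E) (κ : E →ₗ[F] Y) (hi : Function.Injective i)
    (hex : LinearMap.ker κ = LinearMap.range i)
    (hi' : ∀ b w, i (ρ b w) = τ b (i w)) (hκ : ∀ b v, κ (τ b v) = σ b (κ v))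
    (hZ : Z1 τ ≤ B1 τ) (hR : ∀ b, LinearMap.range κ ≤ (LinearMap.range κ).comap (σ b)) :
    dimH1 σ ≤ dimH2 ρ + dimH1 (σ.quotient (LinearMap.range κ) hR) := by
  refine (dimH1_le_sub_add_quotient σ _ hR).trans (Nat.add_le_add_right ?_ _)
  exact dimH1_le_dimH2 (ρV := τ) i κ.rangeRestrict hi (LinearMap.surjective_rangeRestrict _)
    (by rw [LinearMap.ker_rangeRestrict, hex]) hi' (fun b v => Subtype.ext (hκ b v)) hZ

section Extension

variable {F G H B M : Type} [Field F] [Group G] [Group H] [Group B] [AddCommGroup M] [Module F M]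

lemma mem_fixedOf {ρ : Representation F G M} {u : G} {v : M} : v ∈ fixedOf ρ u ↔ ρ u v = v := by
  simp [fixedOf, sub_eq_zero]

variable {π : G →* B} (hπ : Function.Surjective π) (ρ : Representation F G M)

/-- The map from `ker π`-fixed functions to `ker π`-fixed vectors of `Shift ρ`. -/
def invShiftMk (π : G →* B) (ρ : Representation F G M) :
    invSub π (coindRep F G M) →ₗ[F] invSub π (shiftRep ρ) :=
  (shiftMk ρ).restrict fun φ hφ a ha => by rw [← shiftMk_equivariant, hφ a ha]

lemma invShiftMk_equivariant (b : B) (φ : invSub π (coindRep F G M)) :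
    invShiftMk π ρ (invRep hπ (coindRep F G M) b φ) =
      invRep hπ (shiftRep ρ) b (invShiftMk π ρ φ) := by
  obtain ⟨g, rfl⟩ := hπ b
  apply Subtype.ext
  rw [invRep_apply]
  change shiftMk ρ (invRep hπ (coindRep F G M) (π g) φ : G → M) = _
  rw [invRep_apply, shiftMk_equivariant]
  rfl

/-- The `ker π`-fixed vectors of `Shift ρ` that lift to `ker π`-fixed functions. -/
abbrev liftSub (π : G →* B) (ρ : Representation F G M) : Submodule F (invSub π (shiftRep ρ)) :=
  LinearMap.range (invShiftMk π ρ)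

lemma liftSub_stable (b : B) :
    liftSub π ρ ≤ (liftSub π ρ).comap (invRep hπ (shiftRep ρ) b) := by
  rintro _ ⟨φ, rfl⟩
  exact ⟨_, invShiftMk_equivariant hπ ρ b φ⟩

/-- The action on the quotient by the liftable vectors. -/
noncomputable abbrev obstrRep : Representation F B (invSub π (shiftRep ρ) ⧸ liftSub π ρ) :=
  (invRep hπ (shiftRep ρ)).quotient _ (liftSub_stable hπ ρ)

lemma mem_liftSub {y : invSub π (shiftRep ρ)} : y ∈ liftSub π ρ ↔
    ∃ φ : G → M, (∀ a, π a = 1 → ∀ x, φ (x * a) = φ x) ∧ shiftMk ρ φ = y := by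
  constructor
  · rintro ⟨φ, rfl⟩
    exact ⟨φ, fun a ha x => congrFun (φ.2 a ha) x, rfl⟩
  · rintro ⟨φ, hφ, hy⟩
    exact ⟨⟨φ, fun a ha => funext fun x => hφ a ha x⟩, Subtype.ext hy⟩

variable [Finite G] [Finite H] [Finite B] [FiniteDimensional F M]

lemma dimH1_invRep_shift_le : dimH1 (invRep hπ (shiftRep ρ)) ≤
    dimH2 (invRep hπ ρ) + dimH1 (obstrRep hπ ρ) := by
  have hZ : Z1 (invRep hπ (coindRep F G M)) ≤ B1 (invRep hπ (coindRep F G M)) :=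
    Z1_le_B1 (Nat.le_zero.1 ((dimH1_invRep_le hπ _).trans (dimH1_eq_zero
      (coindRep_res_Z1_le (MonoidHom.id G) Function.injective_id)).le))
  refine dimH1_le_dimH2_add ((unitMap ρ).restrict (p := invSub π ρ)
    (q := invSub π (coindRep F G M)) fun v hv a ha => by rw [← unitMap_equivariant, hv a ha])
    (invShiftMk π ρ) ?_ ?_ ?_ (invShiftMk_equivariant hπ ρ) hZ (liftSub_stable hπ ρ)
  · intro v w hvw
    exact Subtype.ext (unitMap_injective ρ (congrArg Subtype.val hvw))
  · ext φ
    rw [LinearMap.mem_ker, LinearMap.mem_range]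
    constructor
    · intro h
      have h2 : shiftMk ρ φ.1 = shiftMk ρ 0 := by
        rw [map_zero]; exact congrArg Subtype.val h
      obtain ⟨m, hm⟩ := (shiftMk_eq_iff ρ _ _).1 h2
      have hm' : unitMap ρ m = φ.1 := by ext x; simp [hm]
      refine ⟨⟨m, fun a ha => unitMap_injective ρ ?_⟩, Subtype.ext hm'⟩
      rw [unitMap_equivariant, hm', φ.2 a ha]
    · rintro ⟨m, rfl⟩
      apply Subtype.ext
      change shiftMk ρ (unitMap ρ m) = 0
      exact (Submodule.Quotient.mk_eq_zero _).2 ⟨_, rfl⟩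
  · intro b v
    obtain ⟨g, rfl⟩ := hπ b
    apply Subtype.ext
    rw [invRep_apply]
    change unitMap ρ (invRep hπ ρ (π g) v : M) = _
    rw [invRep_apply, unitMap_equivariant]
    rfl

lemma finrank_obstr (S : Submodule F (invSub π (shiftRep ρ) ⧸ liftSub π ρ)) :
    finrank F S = finrank F (S.comap (liftSub π ρ).mkQ) - finrank F (liftSub π ρ) := by
  rw [← finrank_map_mkQ, Submodule.map_comap_eq_of_surjective (Submodule.mkQ_surjective _)]
  intro y hy
  rw [Submodule.mem_comap, Submodule.mkQ_apply, (Submodule.Quotient.mk_eq_zero _).2 hy]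
  exact zero_mem _

lemma liftSub_le_comap (S : Submodule F (invSub π (shiftRep ρ) ⧸ liftSub π ρ)) :
    liftSub π ρ ≤ S.comap (liftSub π ρ).mkQ := by
  intro y hy
  rw [Submodule.mem_comap, Submodule.mkQ_apply, (Submodule.Quotient.mk_eq_zero _).2 hy]
  exact zero_mem _

/-- The transgression bound. -/
lemma dimH1_le_inv_add_obstr : dimH1 ρ ≤ dimH1 (invRep hπ ρ) +
    finrank F (invariants (obstrRep hπ ρ)) := by
  rw [add_comm, finrank_obstr, ← Submodule.finrank_map_subtype_eq,
    ← Submodule.finrank_map_subtype_eq (invSub π (shiftRep ρ)) (liftSub π ρ)]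
  refine finrank_sub_le_add (B1_le_Z1 _) (Submodule.map_mono (liftSub_le_comap ρ _)) (B1_le_Z1 _)
    (shiftMk ρ) (((invSub π ρ).subtype.compLeft G).comp (LinearMap.funLeft F _ π)) ?_ ?_ ?_ ?_
  · intro c hc
    have h1 : ∀ g, shiftRep ρ g (shiftMk ρ c) = shiftMk ρ c := fun g => by
      rw [← shiftMk_equivariant, shiftMk_eq_iff]
      exact ⟨c g, fun x => hc x g⟩
    refine ⟨⟨shiftMk ρ c, fun a _ => h1 a⟩, ?_, rfl⟩
    rw [SetLike.mem_coe, Submodule.mem_comap]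
    intro b
    obtain ⟨g, rfl⟩ := hπ b
    have : invRep hπ (shiftRep ρ) (π g) ⟨shiftMk ρ c, fun a _ => h1 a⟩ =
      ⟨shiftMk ρ c, fun a _ => h1 a⟩ := Subtype.ext ((invRep_apply hπ _ g _).trans (h1 g))
    exact congrArg (liftSub π ρ).mkQ this
  · intro c hc
    obtain ⟨m, hm⟩ := mem_B1.1 hc
    have h : shiftMk ρ (fun _ => -m) = shiftMk ρ c := by
      rw [shiftMk_eq_iff]
      exact ⟨-m, fun x => by rw [hm, map_neg]; abel⟩
    refine ⟨invShiftMk π ρ ⟨fun _ => -m, fun a _ => rfl⟩, ⟨_, rfl⟩, h⟩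
  · intro c hc
    obtain ⟨m, hm⟩ := mem_B1.1 hc
    exact mem_B1.2 ⟨m, fun g => by simp [hm, invRep_apply]⟩
  · rintro c hc ⟨y, hy, hyc⟩
    obtain ⟨φ, hφ, hφy⟩ := (mem_liftSub ρ).1 hy
    have : shiftMk ρ c = shiftMk ρ φ := by rw [hφy]; exact hyc.symm
    obtain ⟨m, hm⟩ := (shiftMk_eq_iff _ _ _).1 this
    obtain ⟨c', hc', hcc⟩ := exists_inflation hπ
      (Submodule.sub_mem _ hc (B1_le_Z1 ρ ⟨m, rfl⟩)) (fun a ha => by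
        have h1 := hm 1
        rw [Z1_one hc, map_one, Module.End.one_apply] at h1
        have h2 := hφ a ha 1
        rw [one_mul] at h2
        simp only [Pi.sub_apply, d0, LinearMap.coe_mk, AddHom.coe_mk, hm a, h2]
        linear_combination (norm := abel) -h1)
    refine ⟨c', hc', ⟨m, ?_⟩⟩
    ext g
    simp [hcc]

lemma finrank_fixedOf_obstr_le (h2 : (2 : F) ≠ 0) (e : H →* G) (he : π.ker ≤ e.range) (u : H)
    (hu : π (e u) * π (e u) = 1) (hcov : ∀ a, π (e a) = 1 ∨ π (e a) = π (e u)) :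
    finrank F (fixedOf (obstrRep hπ ρ) (π (e u))) ≤ dimH1 (res ρ e) := by
  set σ := invRep hπ (shiftRep ρ) with hσ
  set t := π (e u) with ht
  obtain ⟨s, hs⟩ := (shiftMk ρ).exists_rightInverse_of_surjective
    (LinearMap.range_eq_top.2 (shiftMk_surjective ρ))
  have hs' : ∀ y, shiftMk ρ (s y) = y := fun y => LinearMap.congr_fun hs y
  let avg : invSub π (shiftRep ρ) →ₗ[F] invSub π (shiftRep ρ) :=
    (2 : F)⁻¹ • (LinearMap.id + σ t)
  have havg : ∀ y, avg y = (2 : F)⁻¹ • (y + σ t y) := fun y => rfl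
  have hσt : ∀ y, σ t (σ t y) = y := fun y => by
    rw [← Module.End.mul_apply, ← map_mul, hu, map_one, Module.End.one_apply]
  have hfix : ∀ (y) (a : H), shiftRep ρ (e a) (avg y : Shift ρ) = avg y := fun y a => by
    rw [← invRep_apply hπ]
    rcases hcov a with h | h
    · rw [h, map_one, Module.End.one_apply]
    · rw [h, ← hσ, havg, map_smul, map_add, hσt, add_comm]
  let δ : invSub π (shiftRep ρ) →ₗ[F] (H → M) := LinearMap.pi fun a =>
    (LinearMap.proj 1).comp ((coindRep F G M (e a) - LinearMap.id).comp
      (s.comp ((invSub π (shiftRep ρ)).subtype.comp avg)))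
  have hδ : ∀ y a, δ y a = s (avg y) (e a) - s (avg y) 1 := fun y a => by simp [δ]
  have hδ' : ∀ y a x, s (avg y) (x * e a) = s (avg y) x + ρ x (δ y a) := fun y a x => by
    have h3 : shiftMk ρ (coindRep F G M (e a) (s (avg y))) = shiftMk ρ (s (avg y)) := by
      rw [shiftMk_equivariant, hs', hfix]
    obtain ⟨m, hm⟩ := (shiftMk_eq_iff _ _ _).1 h3
    have h4 := hm 1
    rw [map_one, Module.End.one_apply, coindRep_apply, one_mul] at h4
    rw [hδ, h4, add_sub_cancel_left]
    exact hm x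
  rw [finrank_obstr]
  refine finrank_sub_le (liftSub_le_comap ρ _) (B1_le_Z1 _) δ ?_ ?_ ?_
  · intro y _ a b
    have := hδ' y b (e a)
    rw [← map_mul] at this
    rw [hδ y (a * b), this, hδ y a]
    simp only [MonoidHom.comp_apply]
    abel
  · intro y hy
    obtain ⟨φ, hφ, hφy⟩ := (mem_liftSub ρ).1 hy
    let ψ : G → M := (2 : F)⁻¹ • (φ + coindRep F G M (e u) φ)
    have hψ : ∀ a, ψ (e a) = ψ 1 := fun a => by
      simp only [ψ, Pi.smul_apply, Pi.add_apply, coindRep_apply, one_mul]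
      rcases hcov a with h | h
      · have h3 := hφ _ h 1
        have h4 := hφ ((e u)⁻¹ * e a * e u) (by simp [h]) (e u)
        rw [one_mul] at h3
        rw [h3, ← h4]
        congr 3
        group
      · have h3 := hφ ((e u)⁻¹ * e a) (by simp [h, ht]) (e u)
        have h4 := hφ (e a * e u) (by rw [map_mul, h, hu]) 1
        rw [mul_inv_cancel_left] at h3
        rw [one_mul] at h4
        rw [h3, h4, add_comm]
    have hψy : shiftMk ρ ψ = shiftMk ρ (s (avg y)) := by
      rw [hs', havg, Submodule.coe_smul, Submodule.coe_add, ht, hσ, invRep_apply, ← hφy,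
        ← shiftMk_equivariant, ← map_add, ← map_smul]
    obtain ⟨m, hm⟩ := (shiftMk_eq_iff _ _ _).1 hψy.symm
    refine mem_B1.2 ⟨m, fun a => ?_⟩
    rw [hδ, hm, hm, hψ]
    simp
  · intro y hy hB
    obtain ⟨m, hm⟩ := mem_B1.1 hB
    have h3 : avg y ∈ liftSub π ρ := by
      refine (mem_liftSub ρ).2 ⟨s (avg y) - unitMap ρ m, ?_, ?_⟩
      · intro a ha x
        obtain ⟨b, rfl⟩ := he ha
        simp only [Pi.sub_apply, hδ', hm, unitMap_apply, map_sub, MonoidHom.comp_apply, map_mul,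
          Module.End.mul_apply]
        abel
      · rw [map_sub, hs', Submodule.mkQ_apply, (Submodule.Quotient.mk_eq_zero (LinearMap.range (unitMap ρ))).2 ⟨m, rfl⟩, sub_zero]
    have h4 : σ t y - y ∈ liftSub π ρ := by
      rw [← Submodule.Quotient.eq]
      exact mem_fixedOf.1 hy
    have h5 : y = avg y - (2 : F)⁻¹ • (σ t y - y) := by
      rw [havg]
      refine Eq.trans ?_ (smul_sub (2 : F)⁻¹ (y + σ t y) (σ t y - y))
      have : y + σ t y - (σ t y - y) = (2 : F) • y := by rw [two_smul]; abel
      rw [this, inv_smul_smul₀ h2]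
    rw [h5]
    exact Submodule.sub_mem _ h3 (Submodule.smul_mem _ _ h4)

/-- The inductive step: bounding the cohomology of an extension. -/
lemma extension_bound (hπ : Function.Surjective π) (ρ : Representation F G M) {d : ℕ} (h2 : (2 : F) ≠ 0) (e : H →* G) (hi : Function.Injective e)
    (he : π.ker ≤ e.range) (u : H) (hu : π (e u) * π (e u) = 1)
    (hcov : ∀ a, π (e a) = 1 ∨ π (e a) = π (e u))
    (hM : finrank F (invSub π ρ) + d * (dimH1 (res ρ e) + dimH2 (res ρ e)) ≤ finrank F M)
    (hB : StrongBound F d B)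
    (hB' : ∀ (Y : Type) [AddCommGroup Y] [Module F Y] [FiniteDimensional F Y]
      (σ : Representation F B Y),
      finrank F (invariants σ) + dimH1 σ ≤ finrank F (fixedOf σ (π (e u)))) :
    finrank F (invariants ρ) + d * (dimH1 ρ + dimH2 ρ) ≤ finrank F M := by
  have a1 := dimH1_le_inv_add_obstr hπ ρ
  have a2 := dimH2_le_shift ρ
  have a3 := dimH1_le_inf_res hπ (shiftRep ρ) e he
  have a4 := dimH1_shift_res_le ρ e hi
  have a5 := dimH1_invRep_shift_le hπ ρ
  have a6 := finrank_fixedOf_obstr_le hπ ρ h2 e he u hu hcov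
  have a7 := hB _ (invRep hπ ρ)
  have a8 := hB' _ (obstrRep hπ ρ)
  have a9 := finrank_invariants_le hπ ρ
  have : dimH1 ρ + dimH2 ρ ≤ dimH1 (invRep hπ ρ) + dimH2 (invRep hπ ρ) +
    (dimH1 (res ρ e) + dimH2 (res ρ e)) := by omega
  have := Nat.mul_le_mul_left d this
  rw [mul_add d (_ + _)] at this
  omega

/-- Extensions of groups satisfying the bound. -/
lemma StrongBound.extension {d : ℕ} (hd : 1 ≤ d) (h2 : (2 : F) ≠ 0)
    (hπ : Function.Surjective π) (e : H →* G)
    (hi : Function.Injective e) (he : π.ker = e.range) (hH : StrongBound F d H)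
    (hB : StrongBound F d B) : StrongBound F d G := fun M _ _ _ ρ => by
  have h1 : ∀ a, π (e a) = 1 := fun a => by
    have : e a ∈ π.ker := he ▸ ⟨a, rfl⟩
    exact this
  refine extension_bound hπ ρ h2 e hi he.le 1 (by simp) (fun a => .inl (h1 a)) ?_ hB ?_
  · refine le_trans (Nat.add_le_add_right (Submodule.finrank_mono ?_) _) (hH M (res ρ e))
    exact fun v hv a => hv _ (h1 a)
  · intro Y _ _ _ σ
    have h3 := hB Y σ
    have h4 : fixedOf σ (π (e 1)) = ⊤ := by
      ext y; simp [mem_fixedOf]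
    rw [h4, finrank_top]
    nlinarith

end Extension

section Average

variable {F T M N : Type} [Field F] [Fintype T] [AddCommGroup M] [Module F M]
  [AddCommGroup N] [Module F N]

/-- The average of a function on a finite type. -/
noncomputable def avgMap (F T M : Type) [Field F] [Fintype T] [AddCommGroup M] [Module F M] :
    (T → M) →ₗ[F] M := (Fintype.card T : F)⁻¹ • ∑ t, LinearMap.proj t

lemma avgMap_apply (φ : T → M) : avgMap F T M φ = (Fintype.card T : F)⁻¹ • ∑ t, φ t := by
  simp [avgMap]

lemma avgMap_const (h : (Fintype.card T : F) ≠ 0) (m : M) : avgMap F T M (fun _ => m) = m := by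
  rw [avgMap_apply, Finset.sum_const, Finset.card_univ, ← Nat.cast_smul_eq_nsmul F,
    inv_smul_smul₀ h]

lemma avgMap_comp (e : Equiv.Perm T) (φ : T → M) :
    avgMap F T M (fun t => φ (e t)) = avgMap F T M φ := by
  rw [avgMap_apply, avgMap_apply, Equiv.sum_comp e]

lemma map_avgMap (l : M →ₗ[F] N) (φ : T → M) :
    l (avgMap F T M φ) = avgMap F T N (fun t => l (φ t)) := by
  rw [avgMap_apply, avgMap_apply, map_smul, map_sum]

end Average

section Homogeneous

variable {F G Ω M : Type} [Field F] [Group G] [MulAction G Ω] [AddCommGroup M] [Module F M]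

/-- Equivariant homogeneous 1-cocycles on `Ω`. -/
def Alt1 (Ω : Type) [MulAction G Ω] (ρ : Representation F G M) : Submodule F (Ω → Ω → M) where
  carrier := {f | (∀ g a b, f (g • a) (g • b) = ρ g (f a b)) ∧
    ∀ a b c, f a b + f b c = f a c}
  zero_mem' := by simp
  add_mem' {f f'} hf hf' := ⟨fun g a b => by simp [hf.1, hf'.1], fun a b c => by
    simp only [Pi.add_apply, ← hf.2 a b c, ← hf'.2 a b c]
    abel⟩
  smul_mem' r f hf := ⟨fun g a b => by simp [hf.1], fun a b c => by
    simp only [Pi.smul_apply, ← hf.2 a b c, smul_add]⟩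

/-- Equivariant homogeneous alternating 2-cocycles on `Ω`. -/
def Alt2 (Ω : Type) [MulAction G Ω] (ρ : Representation F G M) :
    Submodule F (Ω → Ω → Ω → M) where
  carrier := {f | (∀ g a b c, f (g • a) (g • b) (g • c) = ρ g (f a b c)) ∧
    (∀ a b c d, f b c d - f a c d + f a b d - f a b c = 0) ∧
    (∀ a b c, f b a c = - f a b c) ∧ (∀ a b c, f a c b = - f a b c)}
  zero_mem' := by simp
  add_mem' {f f'} hf hf' := by
    refine ⟨fun g a b c => by simp [hf.1, hf'.1], fun a b c d => ?_, fun a b c => ?_,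
      fun a b c => ?_⟩
    · have h1 := hf.2.1 a b c d
      have h2 := hf'.2.1 a b c d
      simp only [Pi.add_apply]
      linear_combination (norm := abel) h1 + h2
    · simp only [Pi.add_apply, hf.2.2.1 a b c, hf'.2.2.1 a b c]; abel
    · simp only [Pi.add_apply, hf.2.2.2 a b c, hf'.2.2.2 a b c]; abel
  smul_mem' r f hf := by
    refine ⟨fun g a b c => by simp [hf.1], fun a b c d => ?_, fun a b c => ?_,
      fun a b c => ?_⟩
    · simp only [Pi.smul_apply, ← smul_sub, ← smul_add, hf.2.1 a b c d, smul_zero]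
    · simp only [Pi.smul_apply, hf.2.2.1 a b c, smul_neg]
    · simp only [Pi.smul_apply, hf.2.2.2 a b c, smul_neg]

variable [Finite G] [MulAction.IsPretransitive G Ω] (ρ : Representation F G M) (o : Ω)

lemma exists_alt1 (hT : (Nat.card (MulAction.stabilizer G o) : F) ≠ 0) {c : G → M}
    (hc : c ∈ Z1 ρ) : ∃ f ∈ Alt1 Ω ρ, ∃ m, ∀ g, c g = f o (g • o) + (ρ g m - m) := by
  have := Fintype.ofFinite (MulAction.stabilizer G o)
  rw [Nat.card_eq_fintype_card] at hT
  let S := avgMap F (MulAction.stabilizer G o) M (fun t => c t)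
  have hS : ∀ t : MulAction.stabilizer G o, c t = S - ρ t S := fun t => by
    have h1 : S = avgMap F (MulAction.stabilizer G o) M (fun s => c (t * s)) :=
      (avgMap_comp (Equiv.mulLeft t) (fun s : MulAction.stabilizer G o => c s)).symm
    have h2 : (fun s : MulAction.stabilizer G o => c (t * s)) =
        (fun _ => c t) + fun s : MulAction.stabilizer G o => ρ t (c s) := by
      ext s; exact hc _ _
    rw [h2, map_add, avgMap_const hT, ← map_avgMap] at h1
    exact eq_sub_of_add_eq h1.symm
  set c' : G → M := c + d0 ρ S with hc'
  have hcc : c' ∈ Z1 ρ := Submodule.add_mem _ hc (B1_le_Z1 ρ ⟨S, rfl⟩)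
  have h0 : ∀ t : MulAction.stabilizer G o, c' t = 0 := fun t => by
    simp [hc', d0, hS]
  have hconst : ∀ g h : G, g • o = h • o → c' g = c' h := fun g h hgh => by
    have h1 := hcc g (g⁻¹ * h)
    rw [mul_inv_cancel_left, h0 ⟨g⁻¹ * h, by
      rw [MulAction.mem_stabilizer_iff, mul_smul, ← hgh, inv_smul_smul]⟩] at h1
    simpa using h1.symm
  choose r hr using fun a : Ω => MulAction.exists_smul_eq G o a
  refine ⟨fun a b => c' (r b) - c' (r a), ⟨fun g a b => ?_, fun a b c => by
    beta_reduce; abel⟩, -S, fun g => ?_⟩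
  · have h1 : ∀ a, c' (r (g • a)) = c' g + ρ g (c' (r a)) := fun a => by
      rw [← hcc]
      apply hconst
      rw [hr, mul_smul, hr]
    beta_reduce
    rw [h1, h1, map_sub]
    abel
  · beta_reduce
    rw [hconst (r (g • o)) g (hr _), hconst (r o) 1 ((hr o).trans (one_smul _ _).symm),
      Z1_one hcc]
    simp [hc', d0]
    abel

lemma dimH1_le_alt1 [Finite Ω] [FiniteDimensional F M]
    (hT : (Nat.card (MulAction.stabilizer G o) : F) ≠ 0) :
    dimH1 ρ ≤ finrank F (Alt1 Ω ρ) := by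
  have := finrank_sub_le_add (B1_le_Z1 ρ) (le_refl (⊥ : Submodule F M)) (bot_le (a := Alt1 Ω ρ)) 0
    { toFun := fun f g => f o (g • o), map_add' := fun _ _ => rfl, map_smul' := fun _ _ => rfl } (by simp) (by simp)
    (fun z hz => by rw [(Submodule.mem_bot F).1 hz]; exact Submodule.zero_mem _) (fun c hc _ => by
      obtain ⟨f, hf, m, hm⟩ := exists_alt1 ρ o hT hc
      exact ⟨f, hf, mem_B1.2 ⟨m, fun g => by simp [hm]⟩⟩)
  simpa [dimH1, finrank_bot] using this

omit [Finite G] [MulAction.IsPretransitive G Ω] in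
/-- Homogeneous 2-cocycles are cohomologous to alternating ones. -/
lemma exists_alternating (h2 : (2 : F) ≠ 0) {f : Ω → Ω → Ω → M}
    (hf : ∀ (g : G) a b c, f (g • a) (g • b) (g • c) = ρ g (f a b c))
    (hcoc : ∀ a b c d, f b c d - f a c d + f a b d - f a b c = 0) :
    ∃ f' ∈ Alt2 Ω ρ, ∃ k : Ω → Ω → M, (∀ (g : G) a b, k (g • a) (g • b) = ρ g (k a b)) ∧
      ∀ a b c, f a b c = f' a b c + (k b c - k a c + k a b) := by
  have hu1 : ∀ a c, f a a c = f a a a := fun a c => by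
    linear_combination (norm := abel) hcoc a a a c
  have hu2 : ∀ a c, f a c c = f c c c := fun a c => by
    linear_combination (norm := abel) - hcoc a c c c
  have hv : ∀ a b, f a b a - f b b b = f b a b - f a a a := fun a b => by
    have h3 := hcoc a b a b
    rw [hu1 a b, hu2 a b] at h3
    linear_combination (norm := abel) -h3
  set k : Ω → Ω → M := fun a b => f a a a + (2 : F)⁻¹ • (f a b a - f b b b) with hk
  have hka : ∀ a b, k a b = f a a a + (2 : F)⁻¹ • (f a b a - f b b b) := fun _ _ => rfl
  have hhalf : ∀ m : M, (2 : F)⁻¹ • m + (2 : F)⁻¹ • m = m := fun m => by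
    rw [← two_smul F, smul_inv_smul₀ h2]
  have hcoc' : ∀ a b c d, (f b c d - (k c d - k b d + k b c)) -
      (f a c d - (k c d - k a d + k a c)) + (f a b d - (k b d - k a d + k a b)) -
      (f a b c - (k b c - k a c + k a b)) = 0 := fun a b c d => by
    linear_combination (norm := abel) hcoc a b c d
  have e1 : ∀ a c, f a a c - (k a c - k a c + k a a) = 0 := fun a c => by
    rw [hka a a, hu1, sub_self (f a a a), smul_zero]; abel
  have e2 : ∀ a c, f a c c - (k c c - k a c + k a c) = 0 := fun a c => by
    rw [hka c c, hu2, sub_self (f c c c), smul_zero]; abel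
  have e3 : ∀ a b, f a b a - (k b a - k a a + k a b) = 0 := fun a b => by
    rw [hka a a, hka a b, hka b a, ← hv a b, sub_self (f a a a), smul_zero]
    linear_combination (norm := abel) - hhalf (f a b a - f b b b)
  refine ⟨fun a b c => f a b c - (k b c - k a c + k a b),
    ⟨fun g a b c => ?_, hcoc', fun a b c => ?_, fun a b c => ?_⟩, k, fun g a b => ?_,
    fun a b c => by beta_reduce; abel⟩
  · simp only [hka, hf, map_sub, map_add, map_smul]
  · beta_reduce
    linear_combination (norm := abel) hcoc' a b a c + e1 a c + e3 a b
  · beta_reduce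
    linear_combination (norm := abel) - hcoc' a b c b + e3 b c + e2 a b
  · simp only [hka, hf, map_sub, map_add, map_smul]

lemma exists_alt2 (h2 : (2 : F) ≠ 0) (hT : (Nat.card (MulAction.stabilizer G o) : F) ≠ 0)
    {f : G × G → M} (hf : f ∈ Z2 ρ) : ∃ f' ∈ Alt2 Ω ρ, ∃ k : G → M, ∀ g h,
      f (g, h) = f' o (g • o) ((g * h) • o) + (ρ g (k h) - k (g * h) + k g) := by
  have := Fintype.ofFinite (MulAction.stabilizer G o)
  set T := MulAction.stabilizer G o
  rw [Nat.card_eq_fintype_card] at hT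
  have hT3 : (Fintype.card (T × T × T) : F) ≠ 0 := by
    rw [Fintype.card_prod, Fintype.card_prod]
    push_cast
    exact mul_ne_zero hT (mul_ne_zero hT hT)
  let φ : G → G → G → M := fun x y z => ρ x (f (x⁻¹ * y, y⁻¹ * z))
  have hφ : ∀ x y z, φ x y z = ρ x (f (x⁻¹ * y, y⁻¹ * z)) := fun _ _ _ => rfl
  have hφe : ∀ g x y z, φ (g * x) (g * y) (g * z) = ρ g (φ x y z) := fun g x y z => by
    simp only [hφ, mul_inv_rev, map_mul, Module.End.mul_apply]
    congr 4 <;> group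
  have hφc : ∀ x y z w, φ y z w - φ x z w + φ x y w - φ x y z = 0 := fun x y z w => by
    have h3 := congrArg (ρ x) (hf (x⁻¹ * y) (y⁻¹ * z) (z⁻¹ * w))
    simp only [map_add, ← Module.End.mul_apply, ← map_mul, mul_inv_cancel_left, mul_assoc] at h3
    simp only [hφ]
    linear_combination (norm := abel) h3
  let E := avgMap F (T × T × T) M
  let Φ : G → G → G → M := fun x y z => E fun t => φ (x * t.1) (y * t.2.1) (z * t.2.2)
  let K : G → G → M := fun x y => E fun t =>
    φ x y (y * t.2.1) - φ x (x * t.1) (y * t.2.1)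
  have hΦe : ∀ g x y z, Φ (g * x) (g * y) (g * z) = ρ g (Φ x y z) := fun g x y z => by
    simp only [Φ, E, map_avgMap, mul_assoc, hφe]
  have hKe : ∀ g x y, K (g * x) (g * y) = ρ g (K x y) := fun g x y => by
    simp only [K, E, map_avgMap, mul_assoc, hφe, map_sub]
  have hΦK : ∀ x y z, φ x y z = Φ x y z + (K y z - K x z + K x y) := fun x y z => by
    have k1 : K y z = E fun t => φ y z (z * t.2.2) - φ y (y * t.2.1) (z * t.2.2) :=
      (avgMap_comp (F := F) (M := M) (T := T × T × T)
        ((Equiv.prodComm T (T × T)).trans (Equiv.prodAssoc T T T)) fun t =>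
        φ y z (z * t.2.1) - φ y (y * t.1) (z * t.2.1)).symm
    have k2 : K x z = E fun t => φ x z (z * t.2.2) - φ x (x * t.1) (z * t.2.2) :=
      (avgMap_comp (F := F) (M := M) (T := T × T × T)
        ((Equiv.refl T).prodCongr (Equiv.prodComm T T)) fun t =>
        φ x z (z * t.2.1) - φ x (x * t.1) (z * t.2.1)).symm
    rw [k1, k2, ← avgMap_const hT3 (φ x y z)]
    simp only [Φ, K, E]
    rw [← map_sub, ← map_add, ← map_add]
    congr 1
    funext t
    simp only [Pi.add_apply, Pi.sub_apply]
    linear_combination (norm := abel) -hφc x (x * t.1) (y * t.2.1) (z * t.2.2) +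
      hφc x y (y * t.2.1) (z * t.2.2) - hφc x y z (z * t.2.2)
  have hΦT : ∀ x y z (r s t : T), Φ (x * r) (y * s) (z * t) = Φ x y z := fun x y z r s t => by
    have := avgMap_comp (F := F) (M := M) (T := T × T × T)
      ((Equiv.mulLeft r).prodCongr ((Equiv.mulLeft s).prodCongr (Equiv.mulLeft t)))
      fun t => φ (x * t.1) (y * t.2.1) (z * t.2.2)
    refine Eq.trans ?_ this
    simp [Φ, E, mul_assoc]
  have hΦc : ∀ x y z w, Φ y z w - Φ x z w + Φ x y w - Φ x y z = 0 := fun x y z w => by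
    have h3 := hφc x y z w
    simp only [hΦK] at h3
    linear_combination (norm := abel) h3
  have hconst : ∀ x y z x' y' z' : G, x • o = x' • o → y • o = y' • o → z • o = z' • o →
      Φ x y z = Φ x' y' z' := by
    have hmem : ∀ x x' : G, x • o = x' • o → x⁻¹ * x' ∈ T := fun x x' h => by
      rw [MulAction.mem_stabilizer_iff, mul_smul, ← h, inv_smul_smul]
    intro x y z x' y' z' hx hy hz
    have h3 := hΦT x y z ⟨_, hmem _ _ hx⟩ ⟨_, hmem _ _ hy⟩ ⟨_, hmem _ _ hz⟩
    simpa using h3.symm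
  choose r hr using fun a : Ω => MulAction.exists_smul_eq G o a
  obtain ⟨f', hf', k, hk, hkf⟩ := exists_alternating ρ h2
    (f := fun a b c => Φ (r a) (r b) (r c)) (fun g a b c => by
      rw [← hΦe]
      apply hconst <;> rw [hr, mul_smul, hr]) (fun a b c d => hΦc _ _ _ _)
  refine ⟨f', hf', fun g => K 1 g + k o (g • o), fun g h => ?_⟩
  have h3 : f (g, h) = φ 1 g (g * h) := by simp [hφ]
  have h4 := hkf o (g • o) ((g * h) • o)
  have h5 : Φ (r o) (r (g • o)) (r ((g * h) • o)) = Φ 1 g (g * h) :=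
    hconst _ _ _ _ _ _ ((hr o).trans (one_smul _ _).symm) (hr _) (hr _)
  have h6 := hKe g 1 h
  have h7 := hk g o (h • o)
  rw [h5] at h4
  rw [mul_one] at h6
  rw [← mul_smul] at h7
  rw [h3, hΦK, h4, map_add, ← h6, ← h7]
  beta_reduce
  abel

lemma dimH2_le_alt2 [Finite Ω] [FiniteDimensional F M] (h2 : (2 : F) ≠ 0)
    (hT : (Nat.card (MulAction.stabilizer G o) : F) ≠ 0) :
    dimH2 ρ ≤ finrank F (Alt2 Ω ρ) := by
  have := finrank_sub_le_add (B2_le_Z2 ρ) (le_refl (⊥ : Submodule F M)) (bot_le (a := Alt2 Ω ρ)) 0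
    { toFun := fun f g => f o (g.1 • o) ((g.1 * g.2) • o), map_add' := fun _ _ => rfl
      map_smul' := fun _ _ => rfl } (by simp) (by simp)
    (fun z hz => by rw [(Submodule.mem_bot F).1 hz]; exact Submodule.zero_mem _) (fun c hc _ => by
      obtain ⟨f, hf, k, hk⟩ := exists_alt2 ρ o h2 hT hc
      exact ⟨f, hf, mem_B2.2 ⟨k, fun g h => by simp [hk]⟩⟩)
  simpa [dimH2, finrank_bot] using this

end Homogeneous

section Seeds

variable {F Ω M : Type} [Field F] [Fintype Ω] [DecidableEq Ω] [AddCommGroup M] [Module F M]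

lemma exists_pair_notMem (hΩ : 5 ≤ Fintype.card Ω) (s : Finset Ω) (hs : s.card ≤ 3) :
    ∃ a b, a ≠ b ∧ a ∉ s ∧ b ∉ s := by
  have h : 1 < sᶜ.card := by rw [Finset.card_compl]; omega
  obtain ⟨a, ha, b, hb, hab⟩ := Finset.one_lt_card.1 h
  exact ⟨a, b, hab, Finset.mem_compl.1 ha, Finset.mem_compl.1 hb⟩

lemma swap_mul_swap_mem {a b c e : Ω} (hab : a ≠ b) (hce : c ≠ e) :
    Equiv.swap a b * Equiv.swap c e ∈ alternatingGroup Ω := by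
  rw [Equiv.Perm.mem_alternatingGroup, Equiv.Perm.sign_mul, Equiv.Perm.sign_swap hab,
    Equiv.Perm.sign_swap hce]
  simp

lemma eq_zero_of_eq_neg (h2 : (2 : F) ≠ 0) {m : M} (h : m = -m) : m = 0 := by
  have h3 : (2 : F) • m = 0 := by rw [two_smul]; nth_rewrite 2 [h]; abel
  exact (smul_eq_zero.1 h3).resolve_left h2

section Alternating

variable {ρ : Representation F (alternatingGroup Ω) M}

lemma Alt2.apply {f : Ω → Ω → Ω → M} (hf : f ∈ Alt2 Ω ρ) {σ : Equiv.Perm Ω}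
    (hσ : σ ∈ alternatingGroup Ω) (a b c : Ω) :
    ρ ⟨σ, hσ⟩ (f a b c) = f (σ a) (σ b) (σ c) := (hf.1 ⟨σ, hσ⟩ a b c).symm

lemma Alt1.apply {f : Ω → Ω → M} (hf : f ∈ Alt1 Ω ρ) {σ : Equiv.Perm Ω}
    (hσ : σ ∈ alternatingGroup Ω) (a b : Ω) :
    ρ ⟨σ, hσ⟩ (f a b) = f (σ a) (σ b) := (hf.1 ⟨σ, hσ⟩ a b).symm

lemma Alt1.self {f : Ω → Ω → M} (hf : f ∈ Alt1 Ω ρ) (a : Ω) : f a a = 0 := by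
  have := hf.2 a a a
  simpa using this

lemma Alt2.eq_zero (hΩ : 5 ≤ Fintype.card Ω) (h2 : (2 : F) ≠ 0) {f : Ω → Ω → Ω → M}
    (hf : f ∈ Alt2 Ω ρ) {i j q : Ω} (hij : i ≠ j) (hiq : i ≠ q) (hjq : j ≠ q)
    (h : f i j q = 0) : f = 0 := by
  have hz : ∀ a c, f a a c = 0 := fun a c => eq_zero_of_eq_neg h2 (hf.2.2.1 a a c)
  have hz' : ∀ a c, f a c c = 0 := fun a c => eq_zero_of_eq_neg h2 (hf.2.2.2 a c c)
  have h1 : ∀ c, f i j c = 0 := fun c => by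
    by_cases hci : c = i
    · rw [hci, hf.2.2.2, hz, neg_zero]
    by_cases hcj : c = j
    · rw [hcj, hz']
    by_cases hcq : c = q
    · rw [hcq, h]
    have h3 := Alt2.apply hf (swap_mul_swap_mem (Ne.symm hcq) hij) i j q
    simp only [Equiv.Perm.mul_apply, Equiv.swap_apply_left, Equiv.swap_apply_right,
      Equiv.swap_apply_of_ne_of_ne hjq (Ne.symm hcj), h, map_zero,
      Equiv.swap_apply_of_ne_of_ne hiq (Ne.symm hci),
      Equiv.swap_apply_of_ne_of_ne hiq.symm hjq.symm] at h3
    rw [hf.2.2.1, ← h3, neg_zero]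
  have h4 : ∀ c d, f i c d = 0 := fun c d => by
    by_cases hci : c = i
    · rw [hci, hz]
    by_cases hcj : c = j
    · rw [hcj, h1]
    obtain ⟨u, v, huv, hu, hv⟩ := exists_pair_notMem hΩ {i, j, c} Finset.card_le_three
    simp only [Finset.mem_insert, Finset.mem_singleton, not_or] at hu hv
    have h3 := Alt2.apply hf (swap_mul_swap_mem (Ne.symm hcj) huv) i j
      ((Equiv.swap j c * Equiv.swap u v).symm d)
    rw [Equiv.apply_symm_apply] at h3
    simp only [Equiv.Perm.mul_apply, h1, map_zero,
      Equiv.swap_apply_of_ne_of_ne (Ne.symm hu.1) (Ne.symm hv.1),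
      Equiv.swap_apply_of_ne_of_ne (Ne.symm hu.2.1) (Ne.symm hv.2.1),
      Equiv.swap_apply_of_ne_of_ne hij (Ne.symm hci), Equiv.swap_apply_left] at h3
    exact h3.symm
  funext a b c
  have h5 := hf.2.1 i a b c
  simpa [h4] using h5

lemma Alt2.eq_zero_of_fixed (hΩ : 5 ≤ Fintype.card Ω) (h2 : (2 : F) ≠ 0) {f : Ω → Ω → Ω → M}
    (hf : f ∈ Alt2 Ω ρ) {i j q : Ω} (hij : i ≠ j) (hiq : i ≠ q) (hjq : j ≠ q)
    (h : f i j q ∈ invariants ρ) : f = 0 := by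
  refine Alt2.eq_zero hΩ h2 hf hij hiq hjq (eq_zero_of_eq_neg h2 ?_)
  obtain ⟨u, v, huv, hu, hv⟩ := exists_pair_notMem hΩ {i, j, q} Finset.card_le_three
  simp only [Finset.mem_insert, Finset.mem_singleton, not_or] at hu hv
  have h3 := Alt2.apply hf (swap_mul_swap_mem hij huv) i j q
  rw [(mem_invariants _ _).1 h] at h3
  simp only [Equiv.Perm.mul_apply,
      Equiv.swap_apply_of_ne_of_ne (Ne.symm hu.1) (Ne.symm hv.1),
      Equiv.swap_apply_of_ne_of_ne (Ne.symm hu.2.1) (Ne.symm hv.2.1),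
      Equiv.swap_apply_of_ne_of_ne (Ne.symm hu.2.2) (Ne.symm hv.2.2),
      Equiv.swap_apply_of_ne_of_ne hiq.symm hjq.symm, Equiv.swap_apply_left,
      Equiv.swap_apply_right] at h3
  exact h3.trans (hf.2.2.1 i j q)

lemma Alt1.eq_zero_of_fixed (hΩ : 5 ≤ Fintype.card Ω) (h2 : (2 : F) ≠ 0) {f : Ω → Ω → M}
    (hf : f ∈ Alt1 Ω ρ) {i j : Ω} (hij : i ≠ j) (h : f i j ∈ invariants ρ) : f = 0 := by
  have hanti : ∀ a b, f b a = - f a b := fun a b => by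
    rw [eq_neg_iff_add_eq_zero, hf.2, Alt1.self hf]
  have h0 : f i j = 0 := by
    obtain ⟨u, v, huv, hu, hv⟩ := exists_pair_notMem hΩ {i, j} (Finset.card_le_two.trans (by simp))
    simp only [Finset.mem_insert, Finset.mem_singleton, not_or] at hu hv
    have h3 := Alt1.apply hf (swap_mul_swap_mem hij huv) i j
    rw [(mem_invariants _ _).1 h] at h3
    simp only [Equiv.Perm.mul_apply,
      Equiv.swap_apply_of_ne_of_ne (Ne.symm hu.1) (Ne.symm hv.1),
      Equiv.swap_apply_of_ne_of_ne (Ne.symm hu.2) (Ne.symm hv.2), Equiv.swap_apply_left,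
      Equiv.swap_apply_right] at h3
    exact eq_zero_of_eq_neg h2 (h3.trans (hanti _ _))
  have h4 : ∀ c, f i c = 0 := fun c => by
    by_cases hci : c = i
    · rw [hci, Alt1.self hf]
    by_cases hcj : c = j
    · rw [hcj, h0]
    obtain ⟨u, v, huv, hu, hv⟩ := exists_pair_notMem hΩ {i, j, c} Finset.card_le_three
    simp only [Finset.mem_insert, Finset.mem_singleton, not_or] at hu hv
    have h3 := Alt1.apply hf (swap_mul_swap_mem (Ne.symm hcj) huv) i j
    simp only [Equiv.Perm.mul_apply, h0, map_zero,
      Equiv.swap_apply_of_ne_of_ne (Ne.symm hu.1) (Ne.symm hv.1),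
      Equiv.swap_apply_of_ne_of_ne (Ne.symm hu.2.1) (Ne.symm hv.2.1),
      Equiv.swap_apply_of_ne_of_ne hij (Ne.symm hci), Equiv.swap_apply_left] at h3
    exact h3.symm
  funext a b
  have h5 := hf.2 i a b
  simpa [h4] using h5

lemma Alt2.eq_zero_of_eq (hΩ : 5 ≤ Fintype.card Ω) (h2 : (2 : F) ≠ 0) {f : Ω → Ω → Ω → M}
    (hf : f ∈ Alt2 Ω ρ) {a b c e : Ω} (hab : a ≠ b) (hac : a ≠ c) (hae : a ≠ e) (hbc : b ≠ c)
    (hbe : b ≠ e) (hce : c ≠ e) (h : f b c e = f a c e) : f = 0 := by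
  have h1 : f a b e = f c b e := by
    have h3 := congrArg (ρ ⟨_, swap_mul_swap_mem hab hac⟩) h
    rw [Alt2.apply hf, Alt2.apply hf] at h3
    simpa [Equiv.Perm.mul_apply, Equiv.swap_apply_def, hab, hac, hae, hbc, hbe, hce, hab.symm,
      hac.symm, hae.symm, hbc.symm, hbe.symm, hce.symm] using h3
  have h4 : f c a e = f b a e := by
    have h3 := congrArg (ρ ⟨_, swap_mul_swap_mem hac hab⟩) h
    rw [Alt2.apply hf, Alt2.apply hf] at h3
    simpa [Equiv.Perm.mul_apply, Equiv.swap_apply_def, hab, hac, hae, hbc, hbe, hce, hab.symm,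
      hac.symm, hae.symm, hbc.symm, hbe.symm, hce.symm] using h3
  refine Alt2.eq_zero hΩ h2 hf hbc hbe hce (eq_zero_of_eq_neg h2 ?_)
  calc f b c e = - f c a e := by rw [h, hf.2.2.1 c a e]
    _ = f a b e := by rw [h4, hf.2.2.1 a b e, neg_neg]
    _ = - f b c e := by rw [h1, hf.2.2.1 b c e]

lemma three_mul_alt2_le [FiniteDimensional F M] (hΩ : 5 ≤ Fintype.card Ω) (h2 : (2 : F) ≠ 0)
    (ρ : Representation F (alternatingGroup Ω) M) :
    3 * finrank F (Alt2 Ω ρ) ≤ finrank F M := by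
  obtain ⟨a, b, hab, -, -⟩ := exists_pair_notMem hΩ ∅ (by simp)
  obtain ⟨c, e, hce, hc, he⟩ := exists_pair_notMem hΩ {a, b} (Finset.card_le_two.trans (by simp))
  simp only [Finset.mem_insert, Finset.mem_singleton, not_or] at hc he
  have hac := Ne.symm hc.1
  have hbc := Ne.symm hc.2
  have hae := Ne.symm he.1
  have hbe := Ne.symm he.2
  let L : (Alt2 Ω ρ × Alt2 Ω ρ × Alt2 Ω ρ) →ₗ[F] M :=
    { toFun := fun x => x.1.1 b c e - x.2.1.1 a c e + x.2.2.1 a b e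
      map_add' := fun x y => by simp; abel
      map_smul' := fun r x => by simp [smul_sub, smul_add] }
  have hL : Function.Injective L := by
    rw [← LinearMap.ker_eq_bot, LinearMap.ker_eq_bot']
    rintro ⟨⟨f1, hf1⟩, ⟨f2, hf2⟩, ⟨f3, hf3⟩⟩ h
    replace h : f1 b c e - f2 a c e + f3 a b e = 0 := h
    have key : ∀ σ (hσ : σ ∈ alternatingGroup Ω), f1 (σ b) (σ c) (σ e) - f2 (σ a) (σ c) (σ e) +
        f3 (σ a) (σ b) (σ e) = 0 := fun σ hσ => by
      rw [← Alt2.apply hf1 hσ, ← Alt2.apply hf2 hσ, ← Alt2.apply hf3 hσ, ← map_sub, ← map_add, h,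
        map_zero]
    have hcyc : ∀ f ∈ Alt2 Ω ρ, ∀ x y z, f z x y = f x y z := fun f hf x y z => by
      rw [hf.2.2.1 x z y, hf.2.2.2 x y z, neg_neg]
    have hrev : ∀ f ∈ Alt2 Ω ρ, ∀ x y z, f z y x = - f x y z := fun f hf x y z => by
      rw [hf.2.2.2 z x y, hcyc f hf]
    have k1 := key _ (swap_mul_swap_mem hab hce)
    have k2 := key _ (swap_mul_swap_mem hac hbe)
    have k3 := key _ (swap_mul_swap_mem hbc hae)
    simp only [Equiv.Perm.mul_apply, Equiv.swap_apply_def, hab, hac, hae, hbc, hbe, hce, hab.symm,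
      hac.symm, hae.symm, hbc.symm, hbe.symm, hce.symm, if_true, if_false] at k1 k2 k3
    have e1 : f1 + f2 - f3 = 0 := by
      refine Alt2.eq_zero_of_eq hΩ h2 (sub_mem (add_mem hf1 hf2) hf3) hab hac hae hbc hbe hce ?_
      simp only [Pi.add_apply, Pi.sub_apply]
      linear_combination (norm := abel) h + k1 - hf3.2.1 a b c e - hf1.2.2.2 a c e +
        hf2.2.2.2 b c e - hf3.2.2.1 a b c
    have e2 : f1 - f2 + f3 = 0 := by
      refine Alt2.eq_zero_of_eq hΩ h2 (add_mem (sub_mem hf1 hf2) hf3) hac hab hae hbc.symm hce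
        hbe ?_
      simp only [Pi.add_apply, Pi.sub_apply]
      rw [hcyc f1 hf1 a b e, hcyc f2 hf2 a b c, ← hcyc f3 hf3 c e b] at k2
      rw [hf1.2.2.1 b c e, hf2.2.2.1 b c e, hf3.2.2.1 b c e]
      linear_combination (norm := abel) - h - k2 + hf2.2.1 a b c e
    have e3 : f1 - f2 - f3 = 0 := by
      refine Alt2.eq_zero_of_eq hΩ h2 (sub_mem (sub_mem hf1 hf2) hf3) hbc hab.symm hbe hac.symm
        hce hae ?_
      simp only [Pi.sub_apply]
      rw [hrev f1 hf1 a b c, hrev f2 hf2 a b e, hrev f3 hf3 a c e] at k3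
      rw [hf1.2.2.1 a c e, hf2.2.2.1 a c e, hf3.2.2.1 a c e, hf1.2.2.1 a b e, hf2.2.2.1 a b e,
        hf3.2.2.1 a b e]
      linear_combination (norm := abel) - h - k3 + hf1.2.1 a b c e
    have z1 : f1 = 0 := eq_zero_of_eq_neg h2 (by
      linear_combination (norm := abel) e1 + e2)
    have z2 : f2 = 0 := eq_zero_of_eq_neg h2 (by
      linear_combination (norm := abel) e1 - e3)
    have z3 : f3 = 0 := by
      rw [z1, z2] at e2
      simpa using e2
    simp [z1, z2, z3]
  have := LinearMap.finrank_le_finrank_of_injective hL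
  rw [finrank_prod, finrank_prod] at this
  omega

end Alternating

section Symmetric

variable (ρ : Representation F (Equiv.Perm Ω) M)

/-- The restriction of a representation of the symmetric group to the alternating group. -/
abbrev resAlt : Representation F (alternatingGroup Ω) M := res ρ (alternatingGroup Ω).subtype

variable {ρ}

lemma mem_resAlt_invariants {m : M} :
    m ∈ invariants (resAlt ρ) ↔ ∀ σ ∈ alternatingGroup Ω, ρ σ m = m :=
  ⟨fun h σ hσ => h ⟨σ, hσ⟩, fun h σ => h σ.1 σ.2⟩

lemma map_mem_resAlt_invariants {m : M} (h : m ∈ invariants (resAlt ρ)) (τ : Equiv.Perm Ω) :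
    ρ τ m ∈ invariants (resAlt ρ) := by
  rw [mem_resAlt_invariants] at *
  intro σ hσ
  have h1 := h (τ⁻¹ * σ * τ) (by
    rw [Equiv.Perm.mem_alternatingGroup] at *
    simp [hσ])
  rw [← Module.End.mul_apply, ← map_mul]
  have h2 : σ * τ = τ * (τ⁻¹ * σ * τ) := by group
  rw [h2, map_mul, Module.End.mul_apply, h1]

lemma Alt1.resAlt {f : Ω → Ω → M} (hf : f ∈ Alt1 Ω ρ) : f ∈ Alt1 Ω (resAlt ρ) :=
  ⟨fun g a b => hf.1 g a b, hf.2⟩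

lemma Alt2.resAlt {f : Ω → Ω → Ω → M} (hf : f ∈ Alt2 Ω ρ) : f ∈ Alt2 Ω (resAlt ρ) :=
  ⟨fun g a b c => hf.1 g a b c, hf.2⟩

omit [Fintype Ω] [DecidableEq Ω] in
lemma Alt1.map {f : Ω → Ω → M} (hf : f ∈ Alt1 Ω ρ) (σ : Equiv.Perm Ω) (a b : Ω) :
    ρ σ (f a b) = f (σ a) (σ b) := (hf.1 σ a b).symm

omit [Fintype Ω] [DecidableEq Ω] in
lemma Alt2.map {f : Ω → Ω → Ω → M} (hf : f ∈ Alt2 Ω ρ) (σ : Equiv.Perm Ω) (a b c : Ω) :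
    ρ σ (f a b c) = f (σ a) (σ b) (σ c) := (hf.1 σ a b c).symm

variable (ρ) in
/-- The signed sum over the symmetric group on three points. -/
def signOp (i j q : Ω) : M →ₗ[F] M :=
  1 - ρ (Equiv.swap i j) - ρ (Equiv.swap j q) - ρ (Equiv.swap i q) +
    ρ (Equiv.swap i j) * ρ (Equiv.swap j q) + ρ (Equiv.swap j q) * ρ (Equiv.swap i j)

omit [Fintype Ω] in
lemma signOp_apply (i j q : Ω) (v : M) : signOp ρ i j q v =
    v - ρ (Equiv.swap i j) v - ρ (Equiv.swap j q) v - ρ (Equiv.swap i q) v +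
    ρ (Equiv.swap i j) (ρ (Equiv.swap j q) v) + ρ (Equiv.swap j q) (ρ (Equiv.swap i j) v) := rfl

lemma signOp_mem {m : M} (h : m ∈ invariants (resAlt ρ)) (i j q : Ω) :
    signOp ρ i j q m ∈ invariants (resAlt ρ) := by
  rw [signOp_apply]
  have h1 := map_mem_resAlt_invariants h
  exact add_mem (add_mem (sub_mem (sub_mem (sub_mem h (h1 _)) (h1 _)) (h1 _))
    (map_mem_resAlt_invariants (h1 _) _)) (map_mem_resAlt_invariants (h1 _) _)

omit [Fintype Ω] in
lemma signOp_eq_zero_left {i j q : Ω} (hij : i ≠ j) (hiq : i ≠ q) (hjq : j ≠ q) {v : M}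
    (h : ρ (Equiv.swap j q) v = v) : signOp ρ i j q v = 0 := by
  have h1 : Equiv.swap j q * Equiv.swap i j = Equiv.swap i q * Equiv.swap j q := by
    ext x
    simp only [Equiv.Perm.mul_apply, Equiv.swap_apply_def]
    split_ifs <;> simp_all
  rw [signOp_apply, ← Module.End.mul_apply (ρ (Equiv.swap j q)) (ρ (Equiv.swap i j)), ← map_mul,
    h1, map_mul, Module.End.mul_apply, h]
  abel

omit [Fintype Ω] in
lemma signOp_eq_zero_right {i j q : Ω} (hij : i ≠ j) (hiq : i ≠ q) (hjq : j ≠ q) {v : M}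
    (h : ρ (Equiv.swap i q) v = v) : signOp ρ i j q v = 0 := by
  have h1 : Equiv.swap i j * Equiv.swap j q = Equiv.swap j q * Equiv.swap i q := by
    ext x
    simp only [Equiv.Perm.mul_apply, Equiv.swap_apply_def]
    split_ifs <;> simp_all
  have h2 : Equiv.swap j q * Equiv.swap i j = Equiv.swap i j * Equiv.swap i q := by
    ext x
    simp only [Equiv.Perm.mul_apply, Equiv.swap_apply_def]
    split_ifs <;> simp_all
  rw [signOp_apply, ← Module.End.mul_apply (ρ (Equiv.swap j q)) (ρ (Equiv.swap i j)), ← map_mul,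
    h2, map_mul, Module.End.mul_apply, h,
    ← Module.End.mul_apply (ρ (Equiv.swap i j)) (ρ (Equiv.swap j q)), ← map_mul, h1, map_mul,
    Module.End.mul_apply, h]
  abel

omit [Fintype Ω] in
lemma signOp_alt2 {i j q o : Ω} (hij : i ≠ j) (hiq : i ≠ q) (hjq : j ≠ q) (hi : o ≠ i)
    (hj : o ≠ j) (hq : o ≠ q) {f : Ω → Ω → Ω → M} (hf : f ∈ Alt2 Ω ρ) :
    signOp ρ i j q (f o i j) = (2 : F) • f i j q := by
  simp only [signOp_apply, Alt2.map hf, Equiv.swap_apply_left, Equiv.swap_apply_right,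
    Equiv.swap_apply_of_ne_of_ne hi hj, Equiv.swap_apply_of_ne_of_ne hi hq,
    Equiv.swap_apply_of_ne_of_ne hj hq, Equiv.swap_apply_of_ne_of_ne hij hiq,
    Equiv.swap_apply_of_ne_of_ne hij.symm hjq, Equiv.swap_apply_of_ne_of_ne hiq.symm hjq.symm]
  rw [two_smul]
  have h1 := hf.2.1 o i j q
  rw [hf.2.2.2 o i j, hf.2.2.2 o j q, hf.2.2.2 o i q]
  linear_combination (norm := abel) -h1 - h1

/-- The detection argument for the symmetric group. -/
lemma seed_injective (hΩ : 5 ≤ Fintype.card Ω) (h2 : (2 : F) ≠ 0) {o q : Ω} (hoq : o ≠ q)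
    {κ ι : Type} [Fintype κ] [Fintype ι] (y : ι → Ω) (hy : Function.Injective y)
    (hyo : ∀ x, y x ≠ o) (hyq : ∀ x, y x ≠ q) (i j : κ → Ω)
    (hio : ∀ k, i k ≠ o) (hiq : ∀ k, i k ≠ q) (hjo : ∀ k, j k ≠ o) (hjq : ∀ k, j k ≠ q)
    (hij : ∀ k, i k ≠ j k)
    (hκ : Function.Injective fun k => s(i k, j k)) {m : M} (hm : m ∈ invariants (resAlt ρ))
    {h : ι → Ω → Ω → M} (hh : ∀ x, h x ∈ Alt1 Ω ρ)
    {f : κ → Ω → Ω → Ω → M} (hf : ∀ k, f k ∈ Alt2 Ω ρ)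
    (h0 : m + ∑ x, h x o (y x) + ∑ k, f k o (i k) (j k) = 0) : m = 0 ∧ h = 0 ∧ f = 0 := by
  have hfz : f = 0 := funext fun k => by
    have hkill : ∀ v : M, ρ (Equiv.swap (i k) q) v = v ∨ ρ (Equiv.swap (j k) q) v = v →
        signOp ρ (i k) (j k) q v = 0 := fun v hv => by
      rcases hv with hv | hv
      · exact signOp_eq_zero_right (hij k) (hiq k) (hjq k) hv
      · exact signOp_eq_zero_left (hij k) (hiq k) (hjq k) hv
    have kh : ∀ x, signOp ρ (i k) (j k) q (h x o (y x)) = 0 := fun x => by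
      apply hkill
      rw [Alt1.map (hh x), Alt1.map (hh x), Equiv.swap_apply_of_ne_of_ne (hio k).symm hoq,
        Equiv.swap_apply_of_ne_of_ne (hjo k).symm hoq]
      by_cases hc : y x = i k
      · right
        rw [Equiv.swap_apply_of_ne_of_ne (hc ▸ hij k) (hyq x)]
      · left
        rw [Equiv.swap_apply_of_ne_of_ne hc (hyq x)]
    have kf : ∀ l, l ≠ k → signOp ρ (i k) (j k) q (f l o (i l) (j l)) = 0 := fun l hl => by
      apply hkill
      rw [Alt2.map (hf l), Alt2.map (hf l), Equiv.swap_apply_of_ne_of_ne (hio k).symm hoq,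
        Equiv.swap_apply_of_ne_of_ne (hjo k).symm hoq]
      by_cases hc : i k ≠ i l ∧ i k ≠ j l
      · left
        rw [Equiv.swap_apply_of_ne_of_ne hc.1.symm (hiq l),
          Equiv.swap_apply_of_ne_of_ne hc.2.symm (hjq l)]
      · right
        have hne : s(i l, j l) ≠ s(i k, j k) := fun h5 => hl (hκ h5)
        have hc' : j k ≠ i l ∧ j k ≠ j l := by
          have := hij k
          have := hij l
          rw [Ne, Sym2.eq_iff] at hne
          grind
        rw [Equiv.swap_apply_of_ne_of_ne hc'.1.symm (hiq l),
          Equiv.swap_apply_of_ne_of_ne hc'.2.symm (hjq l)]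
    have h1 := congrArg (signOp ρ (i k) (j k) q) h0
    rw [map_add, map_add, map_sum, map_sum, map_zero, Finset.sum_eq_zero (fun x _ => kh x),
      Finset.sum_eq_single k (fun l _ hl => kf l hl) (by simp), add_zero,
      signOp_alt2 (hij k) (hiq k) (hjq k) (hio k).symm (hjo k).symm hoq (hf k)] at h1
    refine Alt2.eq_zero_of_fixed hΩ h2 (Alt2.resAlt (hf k)) (hij k) (hiq k) (hjq k) ?_
    have h3 : (2 : F) • f k (i k) (j k) q ∈ invariants (resAlt ρ) := by
      rw [eq_neg_of_add_eq_zero_right h1]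
      exact neg_mem (signOp_mem hm _ _ _)
    have h4 := Submodule.smul_mem _ (2 : F)⁻¹ h3
    rwa [inv_smul_smul₀ h2] at h4
  subst hfz
  have hhz : h = 0 := funext fun x => by
    have h1 := congrArg (fun v => v - ρ (Equiv.swap (y x) q) v) h0
    simp only [Pi.zero_apply, Finset.sum_const_zero, add_zero, map_add, map_zero, sub_zero,
      map_sum, Alt1.map (hh _), Equiv.swap_apply_of_ne_of_ne (hyo x).symm hoq] at h1
    have h3 : ∑ z, h z o (y z) - ∑ z, h z o (Equiv.swap (y x) q (y z)) =
        h x o (y x) - h x o q := by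
      rw [← Finset.sum_sub_distrib, Finset.sum_eq_single x (fun z _ hz => by
        rw [Equiv.swap_apply_of_ne_of_ne (hy.ne hz) (hyq z), sub_self]) (by simp),
        Equiv.swap_apply_left]
    refine Alt1.eq_zero_of_fixed hΩ h2 (Alt1.resAlt (hh x)) (hyq x).symm ?_
    have h4 : h x q (y x) = ρ (Equiv.swap (y x) q) m - m := by
      have h5 := (hh x).2 o q (y x)
      linear_combination (norm := abel) h1 - h3 + h5
    rw [h4]
    exact sub_mem (map_mem_resAlt_invariants hm _) hm
  subst hhz
  exact ⟨by simpa using h0, rfl, rfl⟩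

end Symmetric

end Seeds

section SeedBounds

variable {F Ω M : Type} [Field F] [Fintype Ω] [DecidableEq Ω] [AddCommGroup M] [Module F M]
  [FiniteDimensional F M]

lemma seed_bound (hΩ : 5 ≤ Fintype.card Ω) (h2 : (2 : F) ≠ 0)
    (ρ : Representation F (Equiv.Perm Ω) M) :
    finrank F (invariants (resAlt ρ)) + ((Fintype.card Ω - 2) * finrank F (Alt1 Ω ρ) +
      (Fintype.card Ω - 2).choose 2 * finrank F (Alt2 Ω ρ)) ≤ finrank F M := by
  obtain ⟨o, q, hoq, -, -⟩ := exists_pair_notMem hΩ ∅ (by simp)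
  let ι := {x : Ω // x ∈ ({o, q} : Finset Ω)ᶜ}
  have hι : Fintype.card ι = Fintype.card Ω - 2 := by
    rw [Fintype.card_coe, Finset.card_compl, Finset.card_pair hoq]
  have hιne : ∀ x : ι, x.1 ≠ o ∧ x.1 ≠ q := fun x => by
    have := x.2
    simpa using this
  let κ := {a : Sym2 ι // ¬ a.IsDiag}
  let i : κ → ι := fun k => k.1.out.1
  let j : κ → ι := fun k => k.1.out.2
  have hs : ∀ k : κ, s(i k, j k) = k.1 := fun k => Quot.out_eq k.1
  have hκ : Fintype.card κ = (Fintype.card Ω - 2).choose 2 := by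
    rw [Sym2.card_subtype_not_diag, hι]
  let L : (invariants (resAlt ρ) × (ι → Alt1 Ω ρ) × (κ → Alt2 Ω ρ)) →ₗ[F] M :=
    { toFun := fun x => x.1.1 + ∑ y, (x.2.1 y).1 o y.1 + ∑ k, (x.2.2 k).1 o (i k).1 (j k).1
      map_add' := fun x y => by simp [Finset.sum_add_distrib]; abel
      map_smul' := fun r x => by simp [smul_add, Finset.smul_sum] }
  have hL : Function.Injective L := by
    rw [← LinearMap.ker_eq_bot, LinearMap.ker_eq_bot']
    rintro ⟨m, h, f⟩ h0
    obtain ⟨h1, h3, h4⟩ := seed_injective hΩ h2 hoq (fun x : ι => x.1) Subtype.val_injective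
      (fun x => (hιne x).1) (fun x => (hιne x).2) (fun k : κ => (i k).1) (fun k => (j k).1)
      (fun k => (hιne _).1) (fun k => (hιne _).2) (fun k => (hιne _).1) (fun k => (hιne _).2)
      (fun k hk => k.2 (by
        rw [← hs k, Sym2.mk_isDiag_iff]
        exact Subtype.ext hk))
      (fun k l hkl => by
        have h5 : Sym2.map Subtype.val s(i k, j k) = Sym2.map Subtype.val s(i l, j l) := hkl
        rw [hs, hs] at h5
        exact Subtype.ext (Sym2.map.injective Subtype.val_injective h5))
      m.2 (fun x => (h x).2) (fun k => (f k).2) h0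
    refine Prod.ext (Subtype.ext h1) (Prod.ext (funext fun x => Subtype.ext ?_)
      (funext fun k => Subtype.ext ?_))
    · exact congrFun h3 x
    · exact congrFun h4 k
  have := LinearMap.finrank_le_finrank_of_injective hL
  rw [finrank_prod, finrank_prod, finrank_pi_fintype, finrank_pi_fintype] at this
  simpa [hι, hκ] using this

lemma seed_bound_fixedOf (hΩ : 5 ≤ Fintype.card Ω) (h2 : (2 : F) ≠ 0) (a b : Ω)
    (ρ : Representation F (Equiv.Perm Ω) M) :
    finrank F (invariants ρ) + finrank F (Alt1 Ω ρ) ≤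
      finrank F (fixedOf ρ (Equiv.swap a b)) := by
  obtain ⟨o, q, hoq, ho, hq⟩ :=
    exists_pair_notMem hΩ {a, b} (Finset.card_le_two.trans (by simp))
  have h1 : 0 < (({a, b, o, q} : Finset Ω)ᶜ).card := by
    have := Finset.card_le_four (a := a) (b := b) (c := o) (d := q)
    rw [Finset.card_compl]; omega
  obtain ⟨y, hy⟩ := Finset.card_pos.1 h1
  simp only [Finset.mem_insert, Finset.mem_singleton, not_or, Finset.mem_compl] at ho hq hy
  let L : (invariants ρ × Alt1 Ω ρ) →ₗ[F] fixedOf ρ (Equiv.swap a b) :=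
    { toFun := fun x => ⟨x.1.1 + x.2.1 o y, mem_fixedOf.2 (by
        rw [map_add, x.1.2, Alt1.map x.2.2, Equiv.swap_apply_of_ne_of_ne ho.1 ho.2,
          Equiv.swap_apply_of_ne_of_ne hy.1 hy.2.1])⟩
      map_add' := fun x y => Subtype.ext (by simp; abel)
      map_smul' := fun r x => Subtype.ext (by simp) }
  have hL : Function.Injective L := by
    rw [← LinearMap.ker_eq_bot, LinearMap.ker_eq_bot']
    rintro ⟨m, h⟩ h0
    obtain ⟨h1, h3, -⟩ := seed_injective (κ := Empty) (ι := Unit) hΩ h2 hoq (fun _ => y)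
      (fun _ _ _ => rfl) (fun _ => hy.2.2.1) (fun _ => hy.2.2.2) Empty.elim Empty.elim
      (fun k => k.elim) (fun k => k.elim) (fun k => k.elim) (fun k => k.elim)
      (fun k => k.elim) (fun k => k.elim) (m := m.1) (fun g => m.2 g.1)
      (h := fun _ => h.1) (fun _ => h.2) (f := fun _ => 0) (fun k => k.elim) (by
        have h5 : m.1 + h.1 o y = 0 := congrArg Subtype.val h0
        simpa using h5)
    exact Prod.ext (Subtype.ext h1) (Subtype.ext (congrFun h3 ()))
  have := LinearMap.finrank_le_finrank_of_injective hL
  rwa [finrank_prod] at this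

/-- The module coinduced from the alternating group to the symmetric group. -/
def coindAlt (ρ : Representation F (alternatingGroup Ω) M) :
    Submodule F (Equiv.Perm Ω → M) where
  carrier := {φ | ∀ (a : alternatingGroup Ω) σ, φ (a * σ) = ρ a (φ σ)}
  zero_mem' := by simp
  add_mem' {φ ψ} h h' a σ := by simp [h a σ, h' a σ]
  smul_mem' r φ h a σ := by simp [h a σ]

/-- The symmetric group acts on the coinduced module by right translation. -/
def coindAltRep (ρ : Representation F (alternatingGroup Ω) M) :
    Representation F (Equiv.Perm Ω) (coindAlt ρ) where
  toFun g :=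
    { toFun := fun φ => ⟨fun σ => φ.1 (σ * g), fun a σ => by
        beta_reduce; rw [mul_assoc]; exact φ.2 a _⟩
      map_add' := fun _ _ => rfl
      map_smul' := fun _ _ => rfl }
  map_one' := by ext φ σ; simp
  map_mul' g h := by ext φ σ; simp [mul_assoc]

lemma finrank_coindAlt_le (hΩ : 5 ≤ Fintype.card Ω)
    (ρ : Representation F (alternatingGroup Ω) M) :
    finrank F (coindAlt ρ) ≤ 2 * finrank F M := by
  obtain ⟨a, b, hab, -, -⟩ := exists_pair_notMem hΩ ∅ (by simp)
  let L : coindAlt ρ →ₗ[F] M × M :=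
    { toFun := fun φ => (φ.1 1, φ.1 (Equiv.swap a b))
      map_add' := fun _ _ => rfl
      map_smul' := fun _ _ => rfl }
  have hL : Function.Injective L := by
    rw [← LinearMap.ker_eq_bot, LinearMap.ker_eq_bot']
    rintro ⟨φ, hφ⟩ h0
    have h1 : φ 1 = 0 := congrArg Prod.fst h0
    have h3 : φ (Equiv.swap a b) = 0 := congrArg Prod.snd h0
    refine Subtype.ext (funext fun σ => ?_)
    rcases Int.units_eq_one_or (Equiv.Perm.sign σ) with h | h
    · have := hφ ⟨σ, h⟩ 1
      rwa [mul_one, h1, map_zero] at this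
    · have := hφ ⟨σ * Equiv.swap a b, by
        rw [Equiv.Perm.mem_alternatingGroup, map_mul, h, Equiv.Perm.sign_swap hab]; simp⟩
        (Equiv.swap a b)
      rwa [h3, map_zero, mul_assoc, Equiv.swap_mul_self, mul_one] at this
  have := LinearMap.finrank_le_finrank_of_injective hL
  rw [finrank_prod] at this
  omega

lemma finrank_alt2_le_coindAlt (ρ : Representation F (alternatingGroup Ω) M) :
    finrank F (Alt2 Ω ρ) ≤ finrank F (Alt2 Ω (coindAltRep ρ)) := by
  let L : Alt2 Ω ρ →ₗ[F] Alt2 Ω (coindAltRep ρ) :=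
    { toFun := fun f => ⟨fun a b c => ⟨fun σ => f.1 (σ a) (σ b) (σ c), fun g σ =>
          f.2.1 g (σ a) (σ b) (σ c)⟩,
        fun g a b c => rfl, fun a b c d => Subtype.ext (funext fun σ => f.2.2.1 _ _ _ _),
        fun a b c => Subtype.ext (funext fun σ => f.2.2.2.1 _ _ _),
        fun a b c => Subtype.ext (funext fun σ => f.2.2.2.2 _ _ _)⟩
      map_add' := fun _ _ => rfl
      map_smul' := fun _ _ => rfl }
  refine LinearMap.finrank_le_finrank_of_injective (f := L) fun f f' h => ?_
  refine Subtype.ext (funext fun a => funext fun b => funext fun c => ?_)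
  have h1 := congrFun (congrFun (congrFun (congrArg Subtype.val h) a) b) c
  exact congrFun (congrArg Subtype.val h1) 1

lemma mul_alt2_alternating_le {p : ℕ} (hp : p.Prime) (hΩ : 5 ≤ Fintype.card Ω)
    (hcard : Fintype.card Ω = p)
    (h2 : (2 : F) ≠ 0) (ρ : Representation F (alternatingGroup Ω) M) :
    (p - 2) * finrank F (Alt2 Ω ρ) ≤ finrank F M := by
  by_cases h5 : p = 5
  · subst h5
    exact three_mul_alt2_le hΩ h2 ρ
  have h7 : 7 ≤ p := by
    by_contra h
    have h6 : p = 6 := by omega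
    subst h6
    exact absurd hp (by norm_num)
  have h1 := seed_bound hΩ h2 (coindAltRep ρ)
  have h3 := finrank_coindAlt_le hΩ ρ
  have h4 := finrank_alt2_le_coindAlt ρ
  rw [hcard] at h1
  have h6 : 2 * (p - 2) ≤ (p - 2).choose 2 := by
    rw [Nat.choose_two_right, Nat.le_div_iff_mul_le two_pos, mul_comm 2, mul_assoc]
    exact Nat.mul_le_mul_left _ (by omega)
  have h8 := Nat.mul_le_mul h6 h4
  rw [mul_assoc] at h8
  omega

variable {p : ℕ} [CharP F p]

omit [DecidableEq Ω] in
lemma cast_stabilizer_ne_zero {G : Type} [Group G] [Finite G] [MulAction G Ω]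
    [MulAction.IsPretransitive G Ω]
    (hp : p.Prime) (hcard : Fintype.card Ω = p) (hG : Nat.card G ∣ p.factorial) (o : Ω) :
    (Nat.card (MulAction.stabilizer G o) : F) ≠ 0 := by
  rw [Ne, CharP.cast_eq_zero_iff F p]
  intro h
  have h1 := Subgroup.index_mul_card (MulAction.stabilizer G o)
  rw [MulAction.index_stabilizer_of_transitive, Nat.card_eq_fintype_card, hcard] at h1
  rw [← h1, ← Nat.mul_factorial_pred hp.ne_zero] at hG
  have h3 := h.trans (Nat.dvd_of_mul_dvd_mul_left hp.pos hG)
  rw [hp.dvd_factorial] at h3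
  have := hp.pos
  omega

lemma isPretransitive_alternating (hΩ : 5 ≤ Fintype.card Ω) :
    MulAction.IsPretransitive (alternatingGroup Ω) Ω :=
  ⟨fun x y => by
    by_cases hxy : x = y
    · exact ⟨1, by simpa using hxy⟩
    obtain ⟨a, b, hab, ha, hb⟩ :=
      exists_pair_notMem hΩ {x, y} (Finset.card_le_two.trans (by simp))
    simp only [Finset.mem_insert, Finset.mem_singleton, not_or] at ha hb
    refine ⟨⟨_, swap_mul_swap_mem hxy hab⟩, ?_⟩
    simp [Subgroup.smul_def, Equiv.swap_apply_of_ne_of_ne (Ne.symm ha.1) (Ne.symm hb.1)]⟩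

omit [DecidableEq Ω] in
lemma card_perm_dvd (hcard : Fintype.card Ω = p) : Nat.card (Equiv.Perm Ω) ∣ p.factorial := by
  rw [Nat.card_perm, Nat.card_eq_fintype_card, hcard]

variable (F) in
theorem weakBound_alternating (hp : p.Prime) (hΩ : 5 ≤ Fintype.card Ω)
    (hcard : Fintype.card Ω = p) (h2 : (2 : F) ≠ 0) :
    WeakBound F (p - 2) (alternatingGroup Ω) := by
  intro M _ _ _ ρ
  have := isPretransitive_alternating hΩ
  obtain ⟨o, -, -, -, -⟩ := exists_pair_notMem hΩ ∅ (by simp)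
  refine (Nat.mul_le_mul_left _ (dimH2_le_alt2 ρ o h2 (cast_stabilizer_ne_zero hp hcard
    ((Subgroup.card_subgroup_dvd_card _).trans (card_perm_dvd hcard)) o))).trans
    (mul_alt2_alternating_le hp hΩ hcard h2 ρ)

/-- The bound for the symmetric group on `p` letters. -/
lemma strongBound_resAlt (hp : p.Prime) (hΩ : 5 ≤ Fintype.card Ω)
    (hcard : Fintype.card Ω = p) (h2 : (2 : F) ≠ 0) (ρ : Representation F (Equiv.Perm Ω) M) :
    finrank F (invariants (resAlt ρ)) + (p - 2) * (dimH1 ρ + dimH2 ρ) ≤ finrank F M := by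
  obtain ⟨o, -, -, -, -⟩ := exists_pair_notMem hΩ ∅ (by simp)
  have hs := cast_stabilizer_ne_zero (F := F) hp hcard (card_perm_dvd hcard) o
  have h1 := seed_bound hΩ h2 ρ
  rw [hcard] at h1
  have h6 : p - 2 ≤ (p - 2).choose 2 := by
    rw [Nat.choose_two_right, Nat.le_div_iff_mul_le two_pos]
    exact Nat.mul_le_mul_left _ (by omega)
  have h3 := Nat.mul_le_mul_left (p - 2) (dimH1_le_alt1 ρ o hs)
  have h4 := Nat.mul_le_mul h6 (dimH2_le_alt2 ρ o h2 hs)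
  rw [mul_add]
  omega

lemma invariants_add_dimH1_le (hp : p.Prime) (hΩ : 5 ≤ Fintype.card Ω)
    (hcard : Fintype.card Ω = p) (h2 : (2 : F) ≠ 0) (ρ : Representation F (Equiv.Perm Ω) M)
    (a b : Ω) :
    finrank F (invariants ρ) + dimH1 ρ ≤ finrank F (fixedOf ρ (Equiv.swap a b)) :=
  (Nat.add_le_add_left (dimH1_le_alt1 ρ a
    (cast_stabilizer_ne_zero (F := F) hp hcard (card_perm_dvd hcard) a)) _).trans
    (seed_bound_fixedOf hΩ h2 a b ρ)

variable (F) in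
theorem strongBound_perm (hp : p.Prime) (hΩ : 5 ≤ Fintype.card Ω)
    (hcard : Fintype.card Ω = p) (h2 : (2 : F) ≠ 0) : StrongBound F (p - 2) (Equiv.Perm Ω) := by
  intro M _ _ _ ρ
  refine (Nat.add_le_add_right (Submodule.finrank_mono ?_) _).trans
    (strongBound_resAlt hp hΩ hcard h2 ρ)
  exact fun m hm g => hm g.1

end SeedBounds

section Products

variable {F : Type} [Field F]

/-- Forgetting the first coordinate of a power. -/
def tailHom (S : Type) [Group S] (k : ℕ) : (Fin (k + 1) → S) →* (Fin k → S) where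
  toFun f i := f i.succ
  map_one' := rfl
  map_mul' _ _ := rfl

lemma tailHom_surjective (S : Type) [Group S] (k : ℕ) : Function.Surjective (tailHom S k) :=
  fun g => ⟨Fin.cons 1 g, funext fun i => by simp [tailHom]⟩

lemma tailHom_mulSingle {S : Type} [Group S] (k : ℕ) (s : S) :
    tailHom S k (MonoidHom.mulSingle (fun _ => S) 0 s) = 1 :=
  funext fun i => by simp [tailHom]

lemma ker_tailHom (S : Type) [Group S] (k : ℕ) :
    (tailHom S k).ker = (MonoidHom.mulSingle (fun _ : Fin (k + 1) => S) 0).range := by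
  ext f
  refine ⟨fun hf => ⟨f 0, funext fun i => ?_⟩, ?_⟩
  · refine Fin.cases ?_ (fun j => ?_) i
    · simp
    · have : f j.succ = 1 := congrFun (MonoidHom.mem_ker.1 hf) j
      simp [this]
  · rintro ⟨s, rfl⟩
    exact tailHom_mulSingle k s

lemma StrongBound.pi {S : Type} [Group S] [Finite S] {d : ℕ} (hd : 1 ≤ d) (h2 : (2 : F) ≠ 0)
    (h : StrongBound F d S) : ∀ k, StrongBound F d (Fin k → S)
  | 0 => StrongBound.of_subsingleton
  | k + 1 => StrongBound.extension hd h2 (tailHom_surjective S k) _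
      (fun x y h => by simpa using congrFun h 0) (ker_tailHom S k) h (StrongBound.pi hd h2 h k)

variable {p : ℕ} [CharP F p] {Ω : Type} [Fintype Ω] [DecidableEq Ω]

lemma invariants_add_dimH1_le_pi (hp : p.Prime) (hΩ : 5 ≤ Fintype.card Ω)
    (hcard : Fintype.card Ω = p) (h2 : (2 : F) ≠ 0) {Y : Type} [AddCommGroup Y] [Module F Y]
    [FiniteDimensional F Y] (k : ℕ) (σ : Representation F (Fin (k + 1) → Equiv.Perm Ω) Y)
    (a b : Ω) :
    finrank F (invariants σ) + dimH1 σ ≤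
      finrank F (fixedOf σ (MonoidHom.mulSingle (fun _ => Equiv.Perm Ω) 0 (Equiv.swap a b))) := by
  set e := MonoidHom.mulSingle (fun _ : Fin (k + 1) => Equiv.Perm Ω) 0
  have hπ := tailHom_surjective (Equiv.Perm Ω) k
  have h1 := dimH1_le_inf_res hπ σ e (ker_tailHom _ _).le
  have h3 := finrank_invariants_le hπ σ
  have h4 := StrongBound.pi (by omega) h2 (strongBound_perm F hp hΩ hcard h2) k _ (invRep hπ σ)
  have h5 : finrank F (invSub (tailHom (Equiv.Perm Ω) k) σ) ≤ finrank F (invariants (res σ e)) :=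
    Submodule.finrank_mono fun v hv s => hv _ (tailHom_mulSingle k s)
  have h6 := invariants_add_dimH1_le hp hΩ hcard h2 (res σ e) a b
  have h7 : fixedOf (res σ e) (Equiv.swap a b) = fixedOf σ (e (Equiv.swap a b)) := rfl
  rw [h7] at h6
  have h8 : dimH1 (invRep hπ σ) ≤ (p - 2) * (dimH1 (invRep hπ σ) + dimH2 (invRep hπ σ)) :=
    (Nat.le_add_right _ _).trans (Nat.le_mul_of_pos_left _ (by omega))
  omega

/-- The product of the signs of a family of permutations. -/
def prodSign (Ω : Type) [Fintype Ω] [DecidableEq Ω] (m : ℕ) :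
    (Fin m → Equiv.Perm Ω) →* ℤˣ where
  toFun f := ∏ i, Equiv.Perm.sign (f i)
  map_one' := by simp
  map_mul' f g := by simp [Finset.prod_mul_distrib]

/-- The endomorphism of the symmetric group through the sign onto the group generated by a
transposition. -/
def signSwap (a b : Ω) : Equiv.Perm Ω →* Equiv.Perm Ω where
  toFun s := if Equiv.Perm.sign s = 1 then 1 else Equiv.swap a b
  map_one' := by simp
  map_mul' s t := by
    rcases Int.units_eq_one_or (Equiv.Perm.sign s) with hs | hs <;>
    rcases Int.units_eq_one_or (Equiv.Perm.sign t) with ht | ht <;>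
    simp [hs, ht]

lemma signSwap_apply (a b : Ω) (s : Equiv.Perm Ω) :
    signSwap a b s = if Equiv.Perm.sign s = 1 then 1 else Equiv.swap a b := rfl

lemma sign_signSwap {a b : Ω} (hab : a ≠ b) (s : Equiv.Perm Ω) :
    Equiv.Perm.sign (signSwap a b s) = Equiv.Perm.sign s := by
  rw [signSwap_apply]
  rcases Int.units_eq_one_or (Equiv.Perm.sign s) with hs | hs <;>
    simp [hs, Equiv.Perm.sign_swap hab]

lemma strongBound_ker_prodSign (hp : p.Prime) (hΩ : 5 ≤ Fintype.card Ω)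
    (hcard : Fintype.card Ω = p) (h2 : (2 : F) ≠ 0) (k : ℕ) :
    StrongBound F (p - 2) (prodSign Ω (k + 2)).ker := by
  intro M _ _ _ ρ
  obtain ⟨a, b, hab, -, -⟩ := exists_pair_notMem hΩ ∅ (by simp)
  let π : (prodSign Ω (k + 2)).ker →* (Fin (k + 1) → Equiv.Perm Ω) :=
    (tailHom (Equiv.Perm Ω) (k + 1)).comp (Subgroup.subtype _)
  have hps : ∀ s g, prodSign Ω (k + 2) (Fin.cons s g) =
      Equiv.Perm.sign s * prodSign Ω (k + 1) g := fun s g => by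
    simp [prodSign, Fin.prod_univ_succ]
  have hπ : Function.Surjective π := fun g => by
    rcases Int.units_eq_one_or (prodSign Ω (k + 1) g) with h | h
    · exact ⟨⟨Fin.cons 1 g, by rw [MonoidHom.mem_ker, hps, h]; simp⟩, rfl⟩
    · exact ⟨⟨Fin.cons (Equiv.swap a b) g, by
        rw [MonoidHom.mem_ker, hps, h, Equiv.Perm.sign_swap hab]; simp⟩, rfl⟩
  let e : Equiv.Perm Ω →* (prodSign Ω (k + 2)).ker :=
    MonoidHom.codRestrict
      { toFun := fun s => Fin.cons s (MonoidHom.mulSingle (fun _ : Fin (k + 1) => Equiv.Perm Ω) 0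
          (signSwap a b s))
        map_one' := by
          ext i : 1
          refine Fin.cases ?_ (fun j => ?_) i <;> simp
        map_mul' := fun s t => by
          ext i : 1
          refine Fin.cases ?_ (fun j => ?_) i <;> simp [Pi.mulSingle_mul] } (prodSign Ω (k + 2)).ker
      (fun s => by
        change prodSign Ω (k + 2) (Fin.cons s _) = 1
        rw [hps]
        simp [prodSign, Fin.prod_univ_succ, sign_signSwap hab])
  have hπe : ∀ s, π (e s) = MonoidHom.mulSingle (fun _ : Fin (k + 1) => Equiv.Perm Ω) 0 (signSwap a b s) :=
    fun s => rfl
  have hi : Function.Injective e := fun s t h => congrFun (congrArg Subtype.val h) 0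
  have hswap : signSwap a b (Equiv.swap a b) = Equiv.swap a b := by
    rw [signSwap_apply, Equiv.Perm.sign_swap hab]
    simp
  have he : π.ker ≤ e.range := fun f hf => by
    have h1 : ∀ i : Fin (k + 1), f.1 i.succ = 1 := fun i => congrFun (MonoidHom.mem_ker.1 hf) i
    have h3 : Equiv.Perm.sign (f.1 0) = 1 := by
      have h4 : ∏ i, Equiv.Perm.sign (f.1 i) = 1 := f.2
      rw [Fin.prod_univ_succ] at h4
      simpa [h1] using h4
    refine ⟨f.1 0, Subtype.ext (funext fun i => ?_)⟩
    change (Fin.cons (f.1 0) (MonoidHom.mulSingle (fun _ : Fin (k + 1) => Equiv.Perm Ω) 0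
      (signSwap a b (f.1 0))) : Fin (k + 2) → Equiv.Perm Ω) i = f.1 i
    refine Fin.cases ?_ (fun j => ?_) i
    · simp
    · simp [h1, signSwap_apply, h3]
  refine extension_bound hπ ρ h2 e hi he (Equiv.swap a b) ?_ ?_ ?_
    (StrongBound.pi (by omega) h2 (strongBound_perm F hp hΩ hcard h2) _) ?_
  · rw [hπe, hswap, ← map_mul, Equiv.swap_mul_self, map_one]
  · intro s
    rw [hπe, hπe, hswap, signSwap_apply]
    split_ifs with h
    · left; rw [map_one]
    · right; rfl
  · refine (Nat.add_le_add_right (Submodule.finrank_mono ?_) _).trans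
      (strongBound_resAlt hp hΩ hcard h2 (res ρ e))
    intro v hv s
    refine hv _ ?_
    rw [hπe, Subgroup.coe_subtype, signSwap_apply, if_pos (Equiv.Perm.mem_alternatingGroup.1 s.2), map_one]
  · intro Y _ _ _ σ
    rw [hπe, hswap]
    exact invariants_add_dimH1_le_pi hp hΩ hcard h2 k σ a b

end Products

section Index

variable {F : Type} [Field F] {p : ℕ} [CharP F p] {G H : Type} [Group G] [Group H]
  [Finite G] [Finite H]

lemma index_range_ne_zero (hp : p.Prime) (e : H →* G) (hi : Function.Injective e)
    (h : padicValNat p (Nat.card G) ≤ padicValNat p (Nat.card H)) :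
    (e.range.index : F) ≠ 0 := by
  have := Fact.mk hp
  have h1 := e.range.index_mul_card
  rw [← Nat.card_congr (MonoidHom.ofInjective hi).toEquiv] at h1
  rw [← h1, padicValNat.mul Subgroup.index_ne_zero_of_finite Nat.card_pos.ne'] at h
  rw [Ne, CharP.cast_eq_zero_iff F p]
  intro h2
  have := one_le_padicValNat_of_dvd Subgroup.index_ne_zero_of_finite h2
  omega

lemma padicValNat_of_mul_eq_two_dvd (hp : p.Prime) (hp2 : p ≠ 2) {a b c : ℕ} (hc : c ≠ 0)
    (h : a * b = c) (ha : a ∣ 2) : padicValNat p b = padicValNat p c := by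
  have := Fact.mk hp
  have ha0 : a ≠ 0 := fun h0 => hc (by rw [← h, h0, zero_mul])
  have hb0 : b ≠ 0 := fun h0 => hc (by rw [← h, h0, mul_zero])
  rw [← h, padicValNat.mul ha0 hb0, padicValNat.eq_zero_of_not_dvd (fun hpa =>
    hp2 ((Nat.prime_dvd_prime_iff_eq hp Nat.prime_two).1 (hpa.trans ha))), zero_add]

lemma padicValNat_card_alternating (hp : p.Prime) (hp2 : p ≠ 2) (X : Type) [Fintype X]
    [DecidableEq X] [Nontrivial X] :
    padicValNat p (Nat.card (alternatingGroup X)) = padicValNat p (Fintype.card X).factorial :=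
  padicValNat_of_mul_eq_two_dvd hp hp2 (Nat.factorial_ne_zero _)
    (by rw [two_mul_nat_card_alternatingGroup, Nat.card_perm, Nat.card_eq_fintype_card]) dvd_rfl

end Index

section Wreath

variable (Ω : Type) [Fintype Ω] [DecidableEq Ω] (m : ℕ)

omit [Fintype Ω] [DecidableEq Ω] in
variable {Ω} in
lemma perm_apply_inv (s : Equiv.Perm Ω) (x : Ω) : s (s⁻¹ x) = x := s.apply_symm_apply x

/-- The even elements of the wreath product of `Equiv.Perm Ω` by `Equiv.Perm (Fin m)`. -/
def evenWreath : Subgroup (Equiv.Perm (Fin m) × Equiv.Perm (Fin m × Ω)) where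
  carrier := {w | (∀ x, (w.2 x).1 = w.1 x.1) ∧ Equiv.Perm.sign w.2 = 1}
  one_mem' := by simp
  mul_mem' {v w} hv hw := ⟨fun x => by simp [hv.1, hw.1], by simp [hv.2, hw.2]⟩
  inv_mem' {w} hw := ⟨fun x => by
    rw [Prod.fst_inv, Equiv.Perm.eq_inv_iff_eq, ← hw.1, Prod.snd_inv, perm_apply_inv],
    by simp [hw.2]⟩

/-- The action of the even wreath product on the blocks. -/
def evenWreathProj : evenWreath Ω m →* Equiv.Perm (Fin m) :=
  (MonoidHom.fst _ _).comp (Subgroup.subtype _)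

/-- The action of the even wreath product on the points. -/
def evenWreathPerm : evenWreath Ω m →* Equiv.Perm (Fin m × Ω) :=
  (MonoidHom.snd _ _).comp (Subgroup.subtype _)

lemma sign_evenWreathPerm (w : evenWreath Ω m) : Equiv.Perm.sign (evenWreathPerm Ω m w) = 1 := w.2.2

lemma evenWreathPerm_injective [Nonempty Ω] : Function.Injective (evenWreathPerm Ω m) := by
  refine fun v w h => Subtype.ext (Prod.ext (Equiv.ext fun i => ?_) h)
  obtain ⟨a⟩ := ‹Nonempty Ω›
  rw [← v.2.1 (i, a), ← w.2.1 (i, a)]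
  exact congrArg (fun s : Equiv.Perm (Fin m × Ω) => (s (i, a)).1) h

lemma evenWreathProj_surjective [Nontrivial Ω] (hm : 0 < m) :
    Function.Surjective (evenWreathProj Ω m) := fun τ => by
  obtain ⟨a, b, hab⟩ := exists_pair_ne Ω
  let s : Equiv.Perm (Fin m × Ω) := Equiv.prodCongr τ (Equiv.refl Ω)
  have hs : ∀ x, (s x).1 = τ x.1 := fun x => rfl
  rcases Int.units_eq_one_or (Equiv.Perm.sign s) with h | h
  · exact ⟨⟨(τ, s), hs, h⟩, rfl⟩
  · have hne : ((⟨0, hm⟩, a) : Fin m × Ω) ≠ (⟨0, hm⟩, b) := fun h => hab (congrArg Prod.snd h)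
    refine ⟨⟨(τ, s * Equiv.swap (⟨0, hm⟩, a) (⟨0, hm⟩, b)), fun x => ?_, ?_⟩, rfl⟩
    · change (s (Equiv.swap _ _ x)).1 = τ x.1
      rw [hs, Equiv.swap_apply_def]
      split_ifs with h1 h2
      · rw [h1]
      · rw [h2]
      · rfl
    · change Equiv.Perm.sign (s * Equiv.swap _ _) = 1
      rw [Equiv.Perm.sign_mul, h, Equiv.Perm.sign_swap hne]
      rfl

/-- The even part of the base group of the wreath product. -/
def evenBase : (prodSign Ω m).ker →* evenWreath Ω m where
  toFun f := ⟨(1, Equiv.prodCongrRight f.1), fun _ => rfl, by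
    rw [Equiv.Perm.sign_prodCongrRight]; exact f.2⟩
  map_one' := rfl
  map_mul' _ _ := rfl

lemma evenBase_injective : Function.Injective (evenBase Ω m) := fun _ _ h =>
  Subtype.ext (funext fun i => Equiv.ext fun x => congrArg
    (fun w : evenWreath Ω m => (w.1.2 (i, x)).2) h)

lemma ker_evenWreathProj : (evenWreathProj Ω m).ker = (evenBase Ω m).range := by
  ext w
  refine ⟨fun hw => ?_, ?_⟩
  · have hw1 : w.1.1 = 1 := hw
    have h1 : ∀ x, (w.1.2 x).1 = x.1 := fun x => by rw [w.2.1, hw1]; rfl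
    have h2 : ∀ x, (w.1.2⁻¹ x).1 = x.1 := fun x => by
      rw [← h1, perm_apply_inv]
    let f : Fin m → Equiv.Perm Ω := fun i =>
      { toFun := fun x => (w.1.2 (i, x)).2
        invFun := fun x => (w.1.2⁻¹ (i, x)).2
        left_inv := fun x => by
          have : (i, (w.1.2 (i, x)).2) = w.1.2 (i, x) := Prod.ext (h1 (i, x)).symm rfl
          simp [this]
        right_inv := fun x => by
          have : (i, (w.1.2⁻¹ (i, x)).2) = w.1.2⁻¹ (i, x) := Prod.ext (h2 (i, x)).symm rfl
          beta_reduce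
          rw [this, perm_apply_inv] }
    have hf : Equiv.prodCongrRight f = w.1.2 :=
      Equiv.ext fun x => Prod.ext (h1 x).symm rfl
    refine ⟨⟨f, ?_⟩, Subtype.ext (Prod.ext hw1.symm hf)⟩
    have := Equiv.Perm.sign_prodCongrRight f
    rw [hf] at this
    exact this.symm.trans w.2.2
  · rintro ⟨f, rfl⟩
    rfl

variable {Ω} {F : Type} [Field F] {p : ℕ} [CharP F p]

lemma strongBound_evenWreath (hp : p.Prime) (hΩ : 5 ≤ Fintype.card Ω)
    (hcard : Fintype.card Ω = p) (h2 : (2 : F) ≠ 0) (k : ℕ)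
    (h : StrongBound F (p - 2) (Equiv.Perm (Fin (k + 2)))) :
    StrongBound F (p - 2) (evenWreath Ω (k + 2)) := by
  have : Nontrivial Ω := Fintype.one_lt_card_iff_nontrivial.1 (by omega)
  exact StrongBound.extension (by omega) h2 (evenWreathProj_surjective Ω (k + 2) (by omega))
    (evenBase Ω (k + 2)) (evenBase_injective Ω (k + 2)) (ker_evenWreathProj Ω (k + 2))
    (strongBound_ker_prodSign hp hΩ hcard h2 k) h

omit [CharP F p] in
lemma padicValNat_card_evenWreath (hp : p.Prime) (hΩ : 5 ≤ Fintype.card Ω)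
    (hcard : Fintype.card Ω = p) (hm : 0 < m) :
    padicValNat p (Nat.card (evenWreath Ω m)) = padicValNat p (p * m).factorial := by
  have := Fact.mk hp
  have : Nontrivial Ω := Fintype.one_lt_card_iff_nontrivial.1 (by omega)
  have h1 := (evenWreathProj Ω m).ker.index_mul_card
  rw [Subgroup.index_ker, MonoidHom.range_eq_top.2 (evenWreathProj_surjective Ω m hm),
    Subgroup.card_top, ker_evenWreathProj,
    ← Nat.card_congr (MonoidHom.ofInjective (evenBase_injective Ω m)).toEquiv] at h1
  have h3 : padicValNat p (Nat.card (prodSign Ω m).ker) = m := by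
    have h4 := (prodSign Ω m).ker.index_mul_card
    rw [padicValNat_of_mul_eq_two_dvd hp (by omega) Nat.card_pos.ne' h4]
    · have h5 := padicValNat_factorial_mul (p := p) 1
      rw [mul_one, Nat.factorial_one, padicValNat_one_right, zero_add] at h5
      rw [Nat.card_pi, Finset.prod_const, Nat.card_perm, Nat.card_eq_fintype_card, hcard,
        padicValNat.pow, h5]
      simp
    · rw [Subgroup.index_ker]
      have := (prodSign Ω m).range.card_subgroup_dvd_card
      simpa using this
  rw [← h1, padicValNat.mul Nat.card_pos.ne' Nat.card_pos.ne', h3, padicValNat_factorial_mul,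
    Nat.card_perm, Nat.card_fin]

/-- The even wreath product inside the alternating group on its points and `r` fixed points. -/
def evenWreathAlt (r : ℕ) : evenWreath Ω m →* alternatingGroup ((Fin m × Ω) ⊕ Fin r) :=
  MonoidHom.codRestrict
    ((Equiv.Perm.sumCongrHom (Fin m × Ω) (Fin r)).comp
      ((MonoidHom.inl _ _).comp (evenWreathPerm Ω m))) _ (fun w => by
    rw [Equiv.Perm.mem_alternatingGroup]
    change Equiv.Perm.sign (Equiv.Perm.sumCongr (evenWreathPerm Ω m w) 1) = 1
    rw [Equiv.Perm.sign_sumCongr, sign_evenWreathPerm]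
    simp)

lemma strongBound_alternating_sum (hp : p.Prime) (hΩ : 5 ≤ Fintype.card Ω)
    (hcard : Fintype.card Ω = p) (h2 : (2 : F) ≠ 0) (k r : ℕ) (hr : r < p)
    (h : StrongBound F (p - 2) (Equiv.Perm (Fin (k + 2)))) :
    StrongBound F (p - 2) (alternatingGroup ((Fin (k + 2) × Ω) ⊕ Fin r)) := by
  have := Fact.mk hp
  have : Nontrivial Ω := Fintype.one_lt_card_iff_nontrivial.1 (by omega)
  have hi : Function.Injective (evenWreathAlt (Ω := Ω) (k + 2) r) := fun v w h =>
    evenWreathPerm_injective Ω _ (congrArg Prod.fst (Equiv.Perm.sumCongrHom_injective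
      (congrArg Subtype.val h)))
  refine (strongBound_evenWreath hp hΩ hcard h2 k h).of_index (evenWreathAlt (k + 2) r) hi
    (index_range_ne_zero hp _ hi ?_)
  have : Nontrivial ((Fin (k + 2) × Ω) ⊕ Fin r) := Sum.inl_injective.nontrivial
  rw [padicValNat_card_evenWreath _ hp hΩ hcard (by omega),
    padicValNat_card_alternating hp (by omega)]
  simp only [Fintype.card_sum, Fintype.card_prod, Fintype.card_fin, hcard]
  rw [mul_comm, padicValNat_factorial_mul_add _ hr]

end Wreath

section Main

variable {F : Type} [Field F] {p : ℕ} [CharP F p]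

lemma strongBound_perm_of_alternating (h2 : (2 : F) ≠ 0) {X : Type} [Fintype X] [DecidableEq X]
    [Nontrivial X] {d : ℕ} (h : StrongBound F d (alternatingGroup X)) :
    StrongBound F d (Equiv.Perm X) :=
  h.of_index (alternatingGroup X).subtype Subtype.val_injective (by
    rw [Subgroup.range_subtype, alternatingGroup.index_eq_two]
    exact_mod_cast h2)

lemma strongBound_alternating_fin (hp : p.Prime) (hp5 : 5 ≤ p) (h2 : (2 : F) ≠ 0) {n : ℕ}
    (hn : 2 * p ≤ n) (h : StrongBound F (p - 2) (Equiv.Perm (Fin (n / p)))) :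
    StrongBound F (p - 2) (alternatingGroup (Fin n)) := by
  have hk : 2 ≤ n / p := (Nat.le_div_iff_mul_le hp.pos).2 hn
  obtain ⟨k, hk⟩ := Nat.exists_eq_add_of_le' hk
  rw [hk] at h
  have e : (Fin (k + 2) × Fin p) ⊕ Fin (n % p) ≃ Fin n := Fintype.equivFinOfCardEq (by
    simp only [Fintype.card_sum, Fintype.card_prod, Fintype.card_fin]
    rw [← hk]
    exact Nat.div_add_mod' n p)
  exact (strongBound_alternating_sum hp (by simpa using hp5) (Fintype.card_fin p) h2 k (n % p)
    (Nat.mod_lt _ hp.pos) h).of_mulEquiv e.altCongrHom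

lemma strongBound_of_lt (hp : p.Prime) {G : Type} [Group G] [Finite G] {n d : ℕ} (hn : n < p)
    (hG : Nat.card G ∣ n.factorial) : StrongBound F d G :=
  StrongBound.of_card (by
    rw [Ne, CharP.cast_eq_zero_iff F p]
    exact fun h => absurd ((hp.dvd_factorial).1 (h.trans hG)) (by omega))

lemma padicValNat_factorial_of_lt_two_mul (hp : p.Prime) {n : ℕ} (h1 : p ≤ n) (h2 : n < 2 * p) :
    padicValNat p n.factorial = padicValNat p p.factorial := by
  have := Fact.mk hp
  obtain ⟨r, rfl⟩ := Nat.exists_eq_add_of_le h1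
  simpa using padicValNat_factorial_mul_add (p := p) (n := r) 1 (by omega)

variable (F) in
theorem strongBound_perm_fin (hp : p.Prime) (hp5 : 5 ≤ p) (h2 : (2 : F) ≠ 0) (n : ℕ) :
    StrongBound F (p - 2) (Equiv.Perm (Fin n)) := by
  induction n using Nat.strong_induction_on with
  | _ n ih =>
    by_cases hn : n < p
    · exact strongBound_of_lt hp hn (by rw [Nat.card_perm, Nat.card_fin])
    by_cases hn2 : n < 2 * p
    · have hi := Equiv.Perm.viaEmbeddingHom_injective (Fin.castLEEmb (not_lt.1 hn))
      refine (strongBound_perm F hp (by simpa using hp5) (Fintype.card_fin p) h2).of_index _ hi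
        (index_range_ne_zero hp _ hi ?_)
      simp only [Nat.card_perm, Nat.card_fin]
      exact (padicValNat_factorial_of_lt_two_mul hp (not_lt.1 hn) hn2).le
    · have : Nontrivial (Fin n) := Fin.nontrivial_iff_two_le.2 (by omega)
      exact strongBound_perm_of_alternating h2 (strongBound_alternating_fin hp hp5 h2 (by omega)
        (ih _ (Nat.div_lt_self (by omega) (by omega))))

variable (F) in
theorem weakBound_alternating_fin (hp : p.Prime) (hp5 : 5 ≤ p) (h2 : (2 : F) ≠ 0) (n : ℕ) :
    WeakBound F (p - 2) (alternatingGroup (Fin n)) := by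
  by_cases hn : n < p
  · refine (strongBound_of_lt hp hn ?_).weak
    have := (alternatingGroup (Fin n)).card_subgroup_dvd_card
    rwa [Nat.card_perm, Nat.card_fin] at this
  by_cases hn2 : n < 2 * p
  · have hpn := not_lt.1 hn
    let e := Equiv.Perm.viaEmbeddingHom (Fin.castLEEmb hpn)
    have hi := Equiv.Perm.viaEmbeddingHom_injective (Fin.castLEEmb hpn)
    let e' : alternatingGroup (Fin p) →* alternatingGroup (Fin n) :=
      MonoidHom.codRestrict (e.comp (Subgroup.subtype _)) _ (fun s => by
        rw [Equiv.Perm.mem_alternatingGroup]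
        change Equiv.Perm.sign (Equiv.Perm.viaEmbedding s.1 _) = 1
        rw [Equiv.Perm.viaEmbedding]
        convert (Equiv.Perm.sign_extendDomain s.1 (Equiv.ofInjective _
          (Fin.castLEEmb hpn).injective)).trans s.2 <;> rfl)
    have hi' : Function.Injective e' := fun s t h => Subtype.ext (hi (congrArg Subtype.val h))
    have : Nontrivial (Fin n) := Fin.nontrivial_iff_two_le.2 (by omega)
    have : Nontrivial (Fin p) := Fin.nontrivial_iff_two_le.2 (by omega)
    refine (weakBound_alternating F hp (by simpa using hp5) (Fintype.card_fin p) h2).of_index e' hi'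
      (index_range_ne_zero hp _ hi' ?_)
    rw [padicValNat_card_alternating hp (by omega), padicValNat_card_alternating hp (by omega),
      Fintype.card_fin, Fintype.card_fin]
    exact (padicValNat_factorial_of_lt_two_mul hp hpn hn2).le
  · exact (strongBound_alternating_fin hp hp5 h2 (by omega)
      (strongBound_perm_fin F hp hp5 h2 _)).weak

lemma finrank_groupCohomology_two_le {G M : Type} [Group G] [Finite G] [AddCommGroup M]
    [Module F M] [FiniteDimensional F M] (ρ : Representation F G M) :
    finrank F (groupCohomology (Rep.of ρ) 2) ≤ dimH2 ρ := by
  let l : Z2 ρ →ₗ[F] groupCohomology (Rep.of ρ) 2 :=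
    (groupCohomology.H2π (Rep.of ρ)).hom.comp
      ((Z2 ρ).subtype.codRestrict (groupCohomology.cocycles₂ (Rep.of ρ)) fun f =>
        (groupCohomology.mem_cocycles₂_iff (A := Rep.of ρ) f.1).2
          fun g h j => (f.2 g h j).symm)
  have hl : Function.Surjective l := fun x => by
    induction x using groupCohomology.H2_induction_on with
    | h x => exact ⟨⟨x.1, fun g h j => ((groupCohomology.mem_cocycles₂_iff x.1).1 x.2 g h j).symm⟩, rfl⟩
  have h1 := l.finrank_range_add_finrank_ker
  rw [LinearMap.range_eq_top.2 hl, finrank_top] at h1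
  have h2 : finrank F (B2 ρ) ≤ finrank F (LinearMap.ker l) :=
    LinearMap.finrank_le_finrank_of_injective (f := LinearMap.codRestrict (LinearMap.ker l)
      (Submodule.inclusion (B2_le_Z2 ρ)) (fun f => by
        obtain ⟨c, hc⟩ := mem_B2.1 f.2
        refine (groupCohomology.H2π_eq_zero_iff _).2 ⟨c, funext fun x => ?_⟩
        exact (hc x.1 x.2).symm))
      (fun f f' h => Submodule.inclusion_injective (B2_le_Z2 ρ) (congrArg Subtype.val h))
  unfold dimH2
  omega

end Main

end GroupCoh

/-- Let `p > 3` be prime, `n > 4`, and `G = Aₙ` or `Sₙ`.  If `F` is a field of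
characteristic `p` and `M` a finite-dimensional `FG`-module, then
`(p-2) · dim H²(G,M) ≤ dim M`. -/
theorem stmt_2 (p n : ℕ) (hp : p.Prime) (hp3 : 3 < p) (hn : 4 < n)
    (G : Type) [Group G]
    (hG : Nonempty (G ≃* alternatingGroup (Fin n)) ∨ Nonempty (G ≃* Equiv.Perm (Fin n)))
    (F : Type) [Field F] [CharP F p]
    (M : Type) [AddCommGroup M] [Module F M] [FiniteDimensional F M]
    (ρ : Representation F G M) :
    (p - 2) * Module.finrank F (groupCohomology (Rep.of ρ) 2) ≤ Module.finrank F M := by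
  have h5 : 5 ≤ p := by
    have : p ≠ 4 := fun h => by subst h; exact absurd hp (by decide)
    omega
  have h2 : (2 : F) ≠ 0 := fun h => by
    have := (CharP.cast_eq_zero_iff F p 2).1 (by exact_mod_cast h)
    have := Nat.le_of_dvd two_pos this
    omega
  have : Finite G := hG.elim (fun ⟨e⟩ => Finite.of_equiv _ e.symm.toEquiv)
    (fun ⟨e⟩ => Finite.of_equiv _ e.symm.toEquiv)
  have h : GroupCoh.WeakBound F (p - 2) G := hG.elim
    (fun ⟨e⟩ => (GroupCoh.weakBound_alternating_fin F hp h5 h2 n).of_mulEquiv e.symm)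
    (fun ⟨e⟩ => (GroupCoh.strongBound_perm_fin F hp h5 h2 n).weak.of_mulEquiv e.symm)
  exact (Nat.mul_le_mul_left _ (GroupCoh.finrank_groupCohomology_two_le ρ)).trans (h M ρ)
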